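/- arXiv:1909.10680 — 4 statements merged into one kernel-verified Lean document; each statement's English description precedes it below -/
import Mathlib

section
/- Let q > 5 and γ > 0, and let f : ℝ³ → [0,∞) be measurable with ‖f‖_q := sup_{v∈ℝ³} (1+|v|)^q f(v) < ∞, ρ_f > 0, and T_f > 0. Then there exists a constant C_{q,γ} > 0, depending only on q and γ, such that ‖M_γ(f)‖_q = sup_{v∈ℝ³} (1+|v|)^q M_γ(f)(v) ≤ C_{q,γ} ‖f‖_q, where M_γ(f)(v) := ρ_f (2πT_f)^{-3/2} exp(-γ|v-U_f|²/(2T_f)). In particular, taking γ = 1, the local Maxwellian M(f) := M_1(f) satisfies ‖M(f)‖_q ≤ C_q ‖f‖_q. -/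
open MeasureTheory Real

abbrev E3 := EuclideanSpace ℝ (Fin 3)

lemma integral_one_add_norm_inv_smul_rpow {s : ℝ} (hs : 0 < s) (p : ℝ) :
    ∫ v : E3, (1 + ‖s⁻¹ • v‖) ^ p = s ^ 3 * ∫ v : E3, (1 + ‖v‖) ^ p := by
  rw [Measure.integral_comp_inv_smul_of_nonneg volume (fun v : E3 => (1 + ‖v‖) ^ p) hs.le]
  simp

/-- Chebyshev's inequality: the ball of radius `3 s` about the mean carries most of the mass. -/
lemma mass_le_of_bound_on_closedBall {f : E3 → ℝ} {U : E3} {s M : ℝ} (hs : 0 < s)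
    (hf0 : ∀ v, 0 ≤ f v) (hf : Integrable f)
    (hf2 : Integrable fun v => ‖v - U‖ ^ 2 * f v)
    (hvar : ∫ v, ‖v - U‖ ^ 2 * f v = 3 * s ^ 2 * ∫ v, f v)
    (hM0 : 0 ≤ M) (hM : ∀ v ∈ Metric.closedBall U (3 * s), f v ≤ M) :
    ∫ v, f v ≤ 41 * volume.real (Metric.ball (0 : E3) 1) * M * s ^ 3 := by
  set b := volume.real (Metric.ball (0 : E3) 1)
  have hb : 0 ≤ b := measureReal_nonneg
  have hind : Integrable ((Metric.closedBall U (3 * s)).indicator fun _ : E3 => M) :=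
    (integrable_indicator_iff measurableSet_closedBall).2
      (integrableOn_const (measure_closedBall_lt_top).ne)
  have hle : ∫ v, f v ≤ ∫ v, ((9 * s ^ 2)⁻¹ * (‖v - U‖ ^ 2 * f v)
      + (Metric.closedBall U (3 * s)).indicator (fun _ : E3 => M) v) := by
    refine integral_mono hf ((hf2.const_mul _).add hind) fun v => ?_
    by_cases hv : v ∈ Metric.closedBall U (3 * s)
    · simp only [Set.indicator_of_mem hv]
      have := hM v hv
      have := hf0 v
      have : 0 ≤ (9 * s ^ 2)⁻¹ * (‖v - U‖ ^ 2 * f v) := by positivity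
      linarith
    · simp only [Set.indicator_of_notMem hv, add_zero]
      rw [Metric.mem_closedBall, dist_eq_norm, not_le] at hv
      rw [← mul_assoc]
      refine le_mul_of_one_le_left (hf0 v) ?_
      rw [inv_mul_eq_div, one_le_div (by positivity)]
      nlinarith
  rw [integral_add (hf2.const_mul _) hind, integral_const_mul, hvar,
    integral_indicator measurableSet_closedBall, setIntegral_const,
    Measure.addHaar_real_closedBall _ _ (by positivity)] at hle
  have hthird : (9 * s ^ 2)⁻¹ * (3 * s ^ 2 * ∫ v, f v) = (∫ v, f v) / 3 := by
    field_simp; norm_num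
  rw [hthird] at hle
  simp only [finrank_euclideanSpace_fin, smul_eq_mul] at hle
  have : 0 ≤ b * M * s ^ 3 := by positivity
  change _ ≤ _ + (3 * s) ^ 3 * b * M at hle
  nlinarith

lemma integral_inner_sub_mean_mul {f : E3 → ℝ} {U : E3} (hf : Integrable f)
    (hf1 : Integrable fun v => f v • v) (hρ : 0 < ∫ v, f v)
    (hU : U = (∫ v, f v)⁻¹ • ∫ v, f v • v) :
    Integrable (fun v => inner ℝ U (v - U) * f v) ∧ ∫ v, inner ℝ U (v - U) * f v = 0 := by
  have hint : Integrable fun v => f v • v - f v • U := hf1.sub (hf.smul_const U)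
  have heq : (fun v => inner ℝ U (v - U) * f v) = fun v => inner ℝ U (f v • v - f v • U) := by
    ext v
    rw [← smul_sub, inner_smul_right, mul_comm]
  rw [heq]
  refine ⟨hint.const_inner U, ?_⟩
  rw [integral_inner hint, integral_sub hf1 (hf.smul_const U), integral_smul_const]
  have : (∫ v, f v) • U = ∫ v, f v • v := by
    rw [hU, smul_inv_smul₀ hρ.ne']
  rw [this, sub_self, inner_zero_right]

lemma norm_sq_mul_le {q s N y : ℝ} (hq : 5 < q) (hs : 0 < s) {v : E3} (hy : 0 ≤ y)
    (hN : 0 ≤ N) (h : (1 + ‖v‖) ^ q * y ≤ N) :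
    ‖v‖ ^ 2 * y ≤ s ^ 2 * y + N * 2 ^ (q - 2) * s ^ (2 - q) * (1 + ‖s⁻¹ • v‖) ^ (2 - q) := by
  rcases le_total ‖v‖ s with hv | hv
  · have : ‖v‖ ^ 2 * y ≤ s ^ 2 * y := by gcongr
    have : 0 ≤ N * 2 ^ (q - 2) * s ^ (2 - q) * (1 + ‖s⁻¹ • v‖) ^ (2 - q) := by positivity
    linarith
  · have hv0 : 0 < ‖v‖ := hs.trans_le hv
    have hprod : 2 ^ (q - 2) * s ^ (2 - q) * (1 + ‖s⁻¹ • v‖) ^ (2 - q)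
        = ((s + ‖v‖) / 2) ^ (2 - q) := by
      have h2 : (2 : ℝ) ^ (q - 2) = (2⁻¹ : ℝ) ^ (2 - q) := by
        rw [inv_rpow zero_le_two, ← rpow_neg zero_le_two, neg_sub]
      rw [h2, ← mul_rpow (by positivity) hs.le, ← mul_rpow (by positivity) (by positivity),
        norm_smul, norm_inv, norm_of_nonneg hs.le]
      congr 1
      field_simp
    have hmono : ‖v‖ ^ (2 - q) ≤ ((s + ‖v‖) / 2) ^ (2 - q) :=
      rpow_le_rpow_of_nonpos (by positivity) (by linarith) (by linarith)
    have hNv : ‖v‖ ^ q * y ≤ N :=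
      le_trans (by gcongr; linarith) h
    have hkey : ‖v‖ ^ 2 * y ≤ N * ‖v‖ ^ (2 - q) := by
      calc ‖v‖ ^ 2 * y = (‖v‖ ^ q * y) * ‖v‖ ^ (2 - q) := by
            rw [mul_right_comm, ← rpow_add hv0]
            norm_num
        _ ≤ _ := by gcongr
    have : N * ‖v‖ ^ (2 - q) ≤ N * ((s + ‖v‖) / 2) ^ (2 - q) := by gcongr
    rw [mul_assoc N, mul_assoc N, hprod]
    have : 0 ≤ s ^ 2 * y := by positivity
    linarith

lemma mass_mul_temperature_rpow_le {q s N : ℝ} (hq : 5 < q) (hs : 0 < s) (hN : 0 ≤ N)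
    {f : E3 → ℝ} {U : E3} (hf0 : ∀ v, 0 ≤ f v) (hf : Integrable f)
    (hfN : ∀ v, (1 + ‖v‖) ^ q * f v ≤ N)
    (hf1 : Integrable fun v => f v • v) (hρ : 0 < ∫ v, f v)
    (hU : U = (∫ v, f v)⁻¹ • ∫ v, f v • v)
    (hf2 : Integrable fun v => ‖v - U‖ ^ 2 * f v)
    (hvar : ∫ v, ‖v - U‖ ^ 2 * f v = 3 * s ^ 2 * ∫ v, f v) :
    (∫ v, f v) * s ^ (q - 3) ≤ 2 ^ (q - 2) * (∫ v : E3, (1 + ‖v‖) ^ (2 - q)) * N := by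
  obtain ⟨hi, hi0⟩ := integral_inner_sub_mean_mul hf hf1 hρ hU
  set K := ∫ v : E3, (1 + ‖v‖) ^ (2 - q)
  have hK : 0 ≤ K := integral_nonneg fun v => by positivity
  have htail : Integrable fun v : E3 => (1 + ‖s⁻¹ • v‖) ^ (2 - q) := by
    have h : Integrable fun v : E3 => (1 + ‖v‖) ^ (-(q - 2)) :=
      integrable_one_add_norm (by simp; linarith)
    rw [neg_sub] at h
    exact h.comp_smul (inv_ne_zero hs.ne')
  have hle : ∫ v, (‖v - U‖ ^ 2 * f v + 2 * (inner ℝ U (v - U) * f v)) ≤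
      ∫ v, (s ^ 2 * f v + N * 2 ^ (q - 2) * s ^ (2 - q) * (1 + ‖s⁻¹ • v‖) ^ (2 - q)) := by
    refine integral_mono (hf2.add (hi.const_mul 2)) ((hf.const_mul _).add (htail.const_mul _))
      fun v => le_trans ?_ (norm_sq_mul_le hq hs (hf0 v) hN (hfN v))
    have hsq := norm_add_sq_real U (v - U)
    rw [add_sub_cancel] at hsq
    have := mul_nonneg (sq_nonneg ‖U‖) (hf0 v)
    simp only [hsq]
    linarith
  rw [integral_add hf2 (hi.const_mul 2), integral_const_mul, hi0, hvar,
    integral_add (hf.const_mul _) (htail.const_mul _), integral_const_mul, integral_const_mul,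
    integral_one_add_norm_inv_smul_rpow hs] at hle
  have hsplit : s ^ 2 = s ^ (q - 3) * (s ^ (2 - q) * s ^ 3) := by
    rw [← rpow_natCast s 3, ← rpow_add hs, ← rpow_add hs, ← rpow_natCast s 2]
    congr 1
    push_cast
    ring
  have hpos : 0 < s ^ (2 - q) * s ^ 3 := by positivity
  refine le_of_mul_le_mul_right ?_ hpos
  have hA : (∫ v, f v) * s ^ (q - 3) * (s ^ (2 - q) * s ^ 3) = s ^ 2 * ∫ v, f v := by
    rw [mul_assoc, ← hsplit, mul_comm]
  have : 0 ≤ s ^ 2 * ∫ v, f v := by positivity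
  rw [hA]
  change _ ≤ s ^ 2 * _ + N * 2 ^ (q - 2) * s ^ (2 - q) * (s ^ 3 * K) at hle
  linarith

lemma one_add_rpow_mul_gaussian_le {q γ x : ℝ} (hq : 0 ≤ q) (hγ : 0 < γ) (hx : 0 ≤ x) :
    (1 + x) ^ q * exp (-γ * x ^ 2 / 2) ≤ exp (q ^ 2 / (2 * γ)) := by
  have h : (1 + x) ^ q ≤ exp (x * q) := by
    rw [exp_mul]
    have := add_one_le_exp x
    gcongr
    linarith
  refine (mul_le_mul_of_nonneg_right h (exp_pos _).le).trans ?_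
  rw [← exp_add, exp_le_exp, le_div_iff₀ (by positivity)]
  nlinarith [sq_nonneg (q - γ * x)]

/-- The weight at `v` is at most `A ^ q` times a polynomial in the rescaled distance to `U`,
which the Gaussian absorbs. -/
lemma weight_mul_maxwellian_le {q γ s ρ A B : ℝ} (hq : 0 ≤ q) (hγ : 0 < γ) (hs : 0 < s)
    (hρ : 0 ≤ ρ) {U v : E3} (hUA : 1 + ‖U‖ ≤ A) (hsA : s ≤ A) (h : ρ * A ^ q ≤ B * s ^ 3) :
    (1 + ‖v‖) ^ q * (ρ * (2 * π * s ^ 2) ^ (-(3 : ℝ) / 2) *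
      exp (-γ * ‖v - U‖ ^ 2 / (2 * s ^ 2))) ≤ exp (q ^ 2 / (2 * γ)) * B := by
  have hA : 0 < A := hs.trans_le hsA
  set x := ‖v - U‖ / s with hx
  have hx0 : 0 ≤ x := by positivity
  have hdist : ‖v - U‖ = s * x := by rw [hx]; field_simp
  have hexp : -γ * ‖v - U‖ ^ 2 / (2 * s ^ 2) = -γ * x ^ 2 / 2 := by rw [hdist]; field_simp
  have hv : 1 + ‖v‖ ≤ A * (1 + x) := by
    have h1 : ‖v‖ ≤ ‖U‖ + s * x := by
      have := norm_add_le U (v - U)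
      rwa [add_sub_cancel, hdist] at this
    nlinarith [mul_le_mul_of_nonneg_right hsA hx0]
  have hw : (1 + ‖v‖) ^ q ≤ A ^ q * (1 + x) ^ q := by
    rw [← mul_rpow hA.le (by positivity)]
    gcongr
  have hT : (2 * π * s ^ 2) ^ (-(3 : ℝ) / 2) ≤ (s ^ 3)⁻¹ := by
    have h3 : (s ^ 3)⁻¹ = (s ^ 2) ^ (-(3 : ℝ) / 2) := by
      rw [← rpow_natCast s 2, ← rpow_mul hs.le, ← rpow_natCast s 3, ← rpow_neg hs.le]
      norm_num
    rw [h3]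
    refine rpow_le_rpow_of_nonpos (by positivity) ?_ (by norm_num)
    nlinarith [pi_gt_three, sq_nonneg s]
  have hB : ρ * A ^ q * (s ^ 3)⁻¹ ≤ B := by
    rwa [← div_eq_mul_inv, div_le_iff₀ (by positivity)]
  rw [hexp]
  calc (1 + ‖v‖) ^ q * (ρ * (2 * π * s ^ 2) ^ (-(3 : ℝ) / 2) * exp (-γ * x ^ 2 / 2))
      ≤ (A ^ q * (1 + x) ^ q) * (ρ * (s ^ 3)⁻¹ * exp (-γ * x ^ 2 / 2)) := by gcongr
    _ = ((1 + x) ^ q * exp (-γ * x ^ 2 / 2)) * (ρ * A ^ q * (s ^ 3)⁻¹) := by ring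
    _ ≤ _ := mul_le_mul (one_add_rpow_mul_gaussian_le hq hγ hx0) hB (by positivity)
        (exp_pos _).le

lemma mass_mul_weight_le_of_large_mean {q s N : ℝ} (hq : 0 ≤ q) (hs : 0 < s) (hN : 0 ≤ N)
    {f : E3 → ℝ} {U : E3} (hf0 : ∀ v, 0 ≤ f v) (hf : Integrable f)
    (hfN : ∀ v, (1 + ‖v‖) ^ q * f v ≤ N)
    (hf2 : Integrable fun v => ‖v - U‖ ^ 2 * f v)
    (hvar : ∫ v, ‖v - U‖ ^ 2 * f v = 3 * s ^ 2 * ∫ v, f v) (hU : 6 * s ≤ ‖U‖) :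
    (∫ v, f v) * (1 + ‖U‖) ^ q ≤
      41 * volume.real (Metric.ball (0 : E3) 1) * 2 ^ q * N * s ^ 3 := by
  have hW : 0 < (1 + ‖U‖) ^ q := by positivity
  have h := mass_le_of_bound_on_closedBall (M := 2 ^ q * N / (1 + ‖U‖) ^ q) hs hf0 hf hf2 hvar
    (by positivity) fun v hv => by
      rw [Metric.mem_closedBall, dist_eq_norm, norm_sub_rev] at hv
      have hUv := norm_sub_norm_le U v
      have hw : (1 + ‖U‖) ^ q ≤ 2 ^ q * (1 + ‖v‖) ^ q := by
        rw [← mul_rpow zero_le_two (by positivity)]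
        gcongr
        linarith
      rw [le_div_iff₀ hW]
      calc f v * (1 + ‖U‖) ^ q ≤ f v * (2 ^ q * (1 + ‖v‖) ^ q) :=
            mul_le_mul_of_nonneg_left hw (hf0 v)
        _ = 2 ^ q * ((1 + ‖v‖) ^ q * f v) := by ring
        _ ≤ 2 ^ q * N := by gcongr; exact hfN v
  rw [← le_div_iff₀ hW]
  exact h.trans_eq (by ring)

lemma mass_mul_weight_le_of_small_temperature {q s N : ℝ} (hq : 0 ≤ q) (hs : 0 < s)
    (hs1 : s ≤ 1) (hN : 0 ≤ N) {f : E3 → ℝ} {U : E3} (hf0 : ∀ v, 0 ≤ f v) (hf : Integrable f)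
    (hfN : ∀ v, (1 + ‖v‖) ^ q * f v ≤ N)
    (hf2 : Integrable fun v => ‖v - U‖ ^ 2 * f v)
    (hvar : ∫ v, ‖v - U‖ ^ 2 * f v = 3 * s ^ 2 * ∫ v, f v) :
    (∫ v, f v) * (1 + 6 * s) ^ q ≤
      41 * volume.real (Metric.ball (0 : E3) 1) * 7 ^ q * N * s ^ 3 := by
  have h := mass_le_of_bound_on_closedBall hs hf0 hf hf2 hvar hN fun v _ =>
    (le_mul_of_one_le_left (hf0 v) (one_le_rpow (by simp) hq)).trans (hfN v)
  calc (∫ v, f v) * (1 + 6 * s) ^ q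
      ≤ (41 * volume.real (Metric.ball (0 : E3) 1) * N * s ^ 3) * 7 ^ q := by
        gcongr
        linarith
    _ = _ := by ring

lemma mass_mul_weight_le_of_large_temperature {q s N : ℝ} (hq : 5 < q) (hs1 : 1 ≤ s)
    (hN : 0 ≤ N) {f : E3 → ℝ} {U : E3} (hf0 : ∀ v, 0 ≤ f v) (hf : Integrable f)
    (hfN : ∀ v, (1 + ‖v‖) ^ q * f v ≤ N)
    (hf1 : Integrable fun v => f v • v) (hρ : 0 < ∫ v, f v)
    (hU : U = (∫ v, f v)⁻¹ • ∫ v, f v • v)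
    (hf2 : Integrable fun v => ‖v - U‖ ^ 2 * f v)
    (hvar : ∫ v, ‖v - U‖ ^ 2 * f v = 3 * s ^ 2 * ∫ v, f v) :
    (∫ v, f v) * (1 + 6 * s) ^ q ≤
      7 ^ q * 2 ^ (q - 2) * (∫ v : E3, (1 + ‖v‖) ^ (2 - q)) * N * s ^ 3 := by
  have hs : 0 < s := by linarith
  have h := mass_mul_temperature_rpow_le hq hs hN hf0 hf hfN hf1 hρ hU hf2 hvar
  have hw : (1 + 6 * s) ^ q ≤ 7 ^ q * (s ^ (q - 3) * s ^ 3) := by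
    rw [← rpow_natCast s 3, ← rpow_add hs, Nat.cast_ofNat, sub_add_cancel,
      ← mul_rpow (by norm_num) hs.le]
    gcongr
    linarith
  calc (∫ v, f v) * (1 + 6 * s) ^ q ≤ (∫ v, f v) * (7 ^ q * (s ^ (q - 3) * s ^ 3)) := by gcongr
    _ = 7 ^ q * ((∫ v, f v) * s ^ (q - 3)) * s ^ 3 := by ring
    _ ≤ 7 ^ q * (2 ^ (q - 2) * (∫ v : E3, (1 + ‖v‖) ^ (2 - q)) * N) * s ^ 3 := by gcongr
    _ = _ := by ring

/-- for q > 5 and γ > 0 there is a constant C_{q,γ}, depending only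
on q and γ, such that ‖M_γ(f)‖_q ≤ C_{q,γ} ‖f‖_q, where
M_γ(f)(v) = ρ_f (2πT_f)^{-3/2} exp(-γ|v-U_f|²/(2T_f)).  (Taking γ = 1 gives the
bound for the local Maxwellian M(f).) -/
theorem lem_M_bdd (q γ : ℝ) (hq : 5 < q) (hγ : 0 < γ) :
    ∃ C : ℝ, 0 < C ∧
      ∀ (f : E3 → ℝ), Measurable f → (∀ v, 0 ≤ f v) →
        Integrable f →
        ∀ N : ℝ, (∀ v, (1 + ‖v‖) ^ q * f v ≤ N) →
        ∀ (ρf : ℝ) (Uf : E3) (Tf : ℝ),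
          ρf = ∫ v, f v →
          Integrable (fun v => f v • v) →
          Uf = ρf⁻¹ • ∫ v, f v • v →
          Integrable (fun v => ‖v - Uf‖ ^ 2 * f v) →
          Tf = (3 * ρf)⁻¹ * ∫ v, ‖v - Uf‖ ^ 2 * f v →
          0 < ρf → 0 < Tf →
          ∀ v : E3,
            (1 + ‖v‖) ^ q *
              (ρf * (2 * π * Tf) ^ (-(3 : ℝ) / 2) *
                Real.exp (-γ * ‖v - Uf‖ ^ 2 / (2 * Tf))) ≤ C * N := by
  have hq0 : 0 ≤ q := by linarith
  set b := volume.real (Metric.ball (0 : E3) 1)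
  set K := ∫ v : E3, (1 + ‖v‖) ^ (2 - q)
  have hb : 0 ≤ b := measureReal_nonneg
  have hK : 0 ≤ K := integral_nonneg fun v => by positivity
  set C₁ := 41 * b * 2 ^ q
  set C₂ := 41 * b * 7 ^ q
  set C₃ := 7 ^ q * 2 ^ (q - 2) * K
  have h₁ : 0 ≤ C₁ := by positivity
  have h₂ : 0 ≤ C₂ := by positivity
  have h₃ : 0 ≤ C₃ := by positivity
  refine ⟨exp (q ^ 2 / (2 * γ)) * (C₁ + C₂ + C₃ + 1), by positivity, ?_⟩
  rintro f - hf0 hf N hfN ρ U T hρ hf1 hU hf2 hT hρ0 hT0 v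
  have hN : 0 ≤ N := (mul_nonneg (by positivity) (hf0 0)).trans (hfN 0)
  obtain ⟨s, hs, rfl⟩ : ∃ s, 0 < s ∧ s ^ 2 = T := ⟨√T, sqrt_pos.2 hT0, sq_sqrt hT0.le⟩
  have hvar : ∫ v, ‖v - U‖ ^ 2 * f v = 3 * s ^ 2 * ∫ v, f v := by
    rw [hT, ← hρ]
    field_simp
  subst hρ
  have hmono : ∀ c ≤ C₁ + C₂ + C₃ + 1, c * N * s ^ 3 ≤ (C₁ + C₂ + C₃ + 1) * N * s ^ 3 :=
    fun c hc => by gcongr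
  refine le_of_le_of_eq ?_ (mul_assoc _ _ _).symm
  rcases le_or_gt (6 * s) ‖U‖ with hUs | hUs
  · exact weight_mul_maxwellian_le hq0 hγ hs hρ0.le le_rfl (by linarith)
      ((mass_mul_weight_le_of_large_mean hq0 hs hN hf0 hf hfN hf2 hvar hUs).trans
        (hmono C₁ (by linarith)))
  · refine weight_mul_maxwellian_le hq0 hγ hs hρ0.le (A := 1 + 6 * s) (by linarith) (by linarith) ?_
    rcases le_total s 1 with hs1 | hs1
    · exact (mass_mul_weight_le_of_small_temperature hq0 hs hs1 hN hf0 hf hfN hf2 hvar).trans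
        (hmono C₂ (by linarith))
    · exact (mass_mul_weight_le_of_large_temperature hq hs1 hN hf0 hf hfN hf1 hρ0 hU hf2
        hvar).trans (hmono C₃ (by linarith))
end

section
/- Let q > 5 and let f : ℝ³ → [0,∞) be measurable with ‖f‖_q := sup_{v∈ℝ³} (1+|v|)^q f(v) < ∞, ρ_f > 0, and T_f > 0. Then there exists a constant C_q > 0, depending only on q, such that ρ_f |U_f|^q T_f^{-3/2} ≤ C_q ‖f‖_q. -/
open MeasureTheory Real

/-- Chebyshev's inequality for the mass of `f` outside a ball of radius `2R` around `U`, combined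
with the decay of `f`, when the mean square deviation from `U` is `3R²` and `4R ≤ ‖U‖`. -/
lemma mass_le_of_far_center {q : ℝ} (hq : 0 < q) {f : E3 → ℝ} (hf0 : ∀ v, 0 ≤ f v)
    (hf : Integrable f) {N : ℝ} (hN : ∀ v, (1 + ‖v‖) ^ q * f v ≤ N) {U : E3} {R : ℝ} (hR : 0 < R)
    (hU : 4 * R ≤ ‖U‖) (hf2 : Integrable (fun v => ‖v - U‖ ^ 2 * f v))
    (hvar : ∫ v, ‖v - U‖ ^ 2 * f v = 3 * (∫ v, f v) * R ^ 2) :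
    (∫ v, f v) * ‖U‖ ^ q ≤ 32 * 2 ^ q * volume.real (Metric.ball (0 : E3) 1) * N * R ^ 3 := by
  have hU0 : 0 < ‖U‖ := by linarith
  have hN0 : 0 ≤ N := (mul_nonneg (by positivity) (hf0 0)).trans (hN 0)
  have hpt : ∀ v, f v ≤ (Metric.closedBall U (2 * R)).indicator (fun _ => N / (‖U‖ / 2) ^ q) v
      + (4 * R ^ 2)⁻¹ * (‖v - U‖ ^ 2 * f v) := by
    intro v
    by_cases hv : v ∈ Metric.closedBall U (2 * R)
    · rw [Set.indicator_of_mem hv]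
      have hnorm : ‖U‖ / 2 ≤ 1 + ‖v‖ := by
        have h1 := norm_sub_norm_le U v
        rw [mem_closedBall_iff_norm'] at hv
        linarith
      have hdecay : f v ≤ N / (‖U‖ / 2) ^ q := by
        rw [le_div_iff₀ (by positivity), mul_comm]
        exact (mul_le_mul_of_nonneg_right (rpow_le_rpow (by positivity) hnorm hq.le)
          (hf0 v)).trans (hN v)
      have := hf0 v
      have : 0 ≤ (4 * R ^ 2)⁻¹ * (‖v - U‖ ^ 2 * f v) := by positivity
      linarith
    · rw [Set.indicator_of_notMem hv, zero_add, ← mul_assoc]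
      rw [mem_closedBall_iff_norm, not_le] at hv
      refine le_mul_of_one_le_left (hf0 v) ?_
      rw [inv_mul_eq_div, one_le_div (by positivity)]
      nlinarith
  have hball : IntegrableOn (fun _ : E3 => N / (‖U‖ / 2) ^ q) (Metric.closedBall U (2 * R)) :=
    integrableOn_const measure_closedBall_lt_top.ne
  have hind := hball.integrable_indicator measurableSet_closedBall
  have hint := integral_mono hf (hind.add (hf2.const_mul _)) hpt
  simp only [Pi.add_apply] at hint
  rw [integral_add hind (hf2.const_mul _), integral_const_mul, hvar,
    integral_indicator measurableSet_closedBall, setIntegral_const, smul_eq_mul,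
    Measure.addHaar_real_closedBall _ _ (by positivity), finrank_euclideanSpace_fin,
    div_rpow hU0.le zero_le_two] at hint
  have hUq : 0 < ‖U‖ ^ q := by positivity
  field_simp at hint
  linarith

/-- The tail of the second moment of `f` is controlled by its decay. -/
lemma exists_mass_mul_rpow_le {q : ℝ} (hq : 5 < q) :
    ∃ J : ℝ, 0 ≤ J ∧ ∀ (f : E3 → ℝ), (∀ v, 0 ≤ f v) → Integrable f →
      ∀ N : ℝ, (∀ v, (1 + ‖v‖) ^ q * f v ≤ N) → ∀ R : ℝ, 0 < R →
      Integrable (fun v => ‖v‖ ^ 2 * f v) →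
      3 * (∫ v, f v) * R ^ 2 ≤ ∫ v, ‖v‖ ^ 2 * f v →
      (∫ v, f v) * R ^ q ≤ J * N * R ^ 3 := by
  let h : E3 → ℝ := fun x => (2 : ℝ) ^ (q - 2) * (1 + ‖x‖) ^ (-(q - 2))
  have hh : Integrable h := by
    refine (integrable_one_add_norm ?_).const_mul _
    rw [finrank_euclideanSpace_fin]
    push_cast
    linarith
  have hh0 : ∀ x, 0 ≤ h x := fun x => by positivity
  refine ⟨∫ x, h x, integral_nonneg hh0, fun f hf0 hf N hN R hR hf2 hmom => ?_⟩
  have hN0 : 0 ≤ N := (mul_nonneg (by positivity) (hf0 0)).trans (hN 0)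
  have hRq : 0 < R ^ q := by positivity
  have hpt : ∀ v, ‖v‖ ^ 2 * f v ≤ R ^ 2 * f v + N * R ^ 2 / R ^ q * h (R⁻¹ • v) := by
    intro v
    have hfv := hf0 v
    rcases le_or_gt ‖v‖ R with hv | hv
    · have := mul_nonneg (by positivity : 0 ≤ N * R ^ 2 / R ^ q) (hh0 (R⁻¹ • v))
      have : ‖v‖ ^ 2 * f v ≤ R ^ 2 * f v := by gcongr
      linarith
    · have hv0 : 0 < ‖v‖ := hR.trans hv
      have hdecay : f v ≤ N / ‖v‖ ^ q := by
        rw [le_div_iff₀ (by positivity), mul_comm]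
        refine le_trans ?_ (hN v)
        gcongr
        linarith
      have hcmp : ‖v‖ ^ (-(q - 2)) ≤ R ^ (-(q - 2)) * h (R⁻¹ • v) := by
        have hn : 1 + ‖R⁻¹ • v‖ = (R + ‖v‖) / R := by
          rw [norm_smul, norm_inv, norm_of_nonneg hR.le]
          field_simp
        have h2 : (2 : ℝ) ^ (q - 2) = 2⁻¹ ^ (-(q - 2)) := by
          rw [inv_rpow zero_le_two, rpow_neg zero_le_two, inv_inv]
        have heq : R ^ (-(q - 2)) * h (R⁻¹ • v) = ((R + ‖v‖) / 2) ^ (-(q - 2)) := by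
          simp only [h]
          rw [hn, h2, ← mul_rpow (by positivity) (by positivity),
            ← mul_rpow (by positivity) (by positivity)]
          congr 1
          field_simp
        rw [heq]
        exact rpow_le_rpow_of_nonpos (by positivity) (by linarith) (by linarith)
      have hpow : ∀ x : ℝ, 0 < x → x ^ (-(q - 2)) = x ^ 2 / x ^ q := fun x hx => by
        rw [neg_sub, rpow_sub hx, rpow_two]
      rw [hpow _ hv0, hpow _ hR] at hcmp
      calc ‖v‖ ^ 2 * f v ≤ ‖v‖ ^ 2 * (N / ‖v‖ ^ q) := by gcongr
        _ = N * (‖v‖ ^ 2 / ‖v‖ ^ q) := by ring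
        _ ≤ N * (R ^ 2 / R ^ q * h (R⁻¹ • v)) := by gcongr
        _ = N * R ^ 2 / R ^ q * h (R⁻¹ • v) := by ring
        _ ≤ _ := le_add_of_nonneg_left (by positivity)
  have hscaled : Integrable (fun v => h (R⁻¹ • v)) := hh.comp_smul (inv_ne_zero hR.ne')
  have hint := integral_mono hf2 ((hf.const_mul _).add (hscaled.const_mul _)) hpt
  simp only [Pi.add_apply] at hint
  rw [integral_add (hf.const_mul _) (hscaled.const_mul _), integral_const_mul, integral_const_mul,
    Measure.integral_comp_inv_smul_of_nonneg _ _ hR.le, finrank_euclideanSpace_fin,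
    smul_eq_mul] at hint
  have hmass : 2 * (∫ v, f v) * R ^ 2 ≤ (∫ x, h x) * N * R ^ 3 / R ^ q * R ^ 2 := by
    have : N * R ^ 2 / R ^ q * (R ^ 3 * ∫ x, h x) = (∫ x, h x) * N * R ^ 3 / R ^ q * R ^ 2 := by
      ring
    linarith
  have hmass' := le_of_mul_le_mul_right hmass (by positivity)
  rw [le_div_iff₀ hRq] at hmass'
  have : 0 ≤ (∫ v, f v) * R ^ q := mul_nonneg (integral_nonneg hf0) hRq.le
  linarith

/-- The second moment about the origin is the one about the mean `U` plus `ρ‖U‖²`. -/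
lemma integrable_and_integral_norm_sq_mul {f : E3 → ℝ} (hf : Integrable f)
    (hf1 : Integrable (fun v => f v • v)) {U : E3}
    (hU : ∫ v, f v • v = (∫ v, f v) • U) (hf2 : Integrable (fun v => ‖v - U‖ ^ 2 * f v)) :
    Integrable (fun v => ‖v‖ ^ 2 * f v) ∧
      ∫ v, ‖v‖ ^ 2 * f v = (∫ v, ‖v - U‖ ^ 2 * f v) + (∫ v, f v) * ‖U‖ ^ 2 := by
  have hexp : (fun v => ‖v‖ ^ 2 * f v) = fun v =>
      ‖v - U‖ ^ 2 * f v + (2 * inner ℝ U (f v • v) - ‖U‖ ^ 2 * f v) := by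
    funext v
    rw [norm_sub_sq_real, inner_smul_right, real_inner_comm]
    ring
  have hin : Integrable (fun v => 2 * inner ℝ U (f v • v)) := (hf1.const_inner U).const_mul 2
  have hrest : Integrable (fun v => 2 * inner ℝ U (f v • v) - ‖U‖ ^ 2 * f v) :=
    hin.sub (hf.const_mul _)
  rw [hexp]
  refine ⟨hf2.add hrest, ?_⟩
  rw [integral_add hf2 hrest, integral_sub hin (hf.const_mul _), integral_const_mul,
    integral_const_mul, integral_inner hf1, hU, inner_smul_right, real_inner_self_eq_norm_sq]
  ring

/-- for q > 5 there is a constant C_q, depending only on q, with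
ρ_f |U_f|^q T_f^{-3/2} ≤ C_q ‖f‖_q. -/
theorem macro_intermediate_bound (q : ℝ) (hq : 5 < q) :
    ∃ C : ℝ, 0 < C ∧
      ∀ (f : E3 → ℝ), Measurable f → (∀ v, 0 ≤ f v) →
        Integrable f →
        ∀ N : ℝ, (∀ v, (1 + ‖v‖) ^ q * f v ≤ N) →
        ∀ (ρf : ℝ) (Uf : E3) (Tf : ℝ),
          ρf = ∫ v, f v →
          Integrable (fun v => f v • v) →
          Uf = ρf⁻¹ • ∫ v, f v • v →
          Integrable (fun v => ‖v - Uf‖ ^ 2 * f v) →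
          Tf = (3 * ρf)⁻¹ * ∫ v, ‖v - Uf‖ ^ 2 * f v →
          0 < ρf → 0 < Tf →
          ρf * ‖Uf‖ ^ q * Tf ^ (-(3 : ℝ) / 2) ≤ C * N := by
  obtain ⟨J, hJ0, hJ⟩ := exists_mass_mul_rpow_le hq
  have hV : 0 ≤ volume.real (Metric.ball (0 : E3) 1) := measureReal_nonneg
  refine ⟨4 ^ q * J + 32 * 2 ^ q * volume.real (Metric.ball (0 : E3) 1) + 1, by positivity, ?_⟩
  intro f _ hf0 hf N hN ρ U T hρ hf1 hU hf2 hT hρ0 hT0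
  have hN0 : 0 ≤ N := (mul_nonneg (by positivity) (hf0 0)).trans (hN 0)
  obtain ⟨R, hR, rfl⟩ : ∃ R : ℝ, 0 < R ∧ T = R ^ 2 :=
    ⟨√T, sqrt_pos.2 hT0, (sq_sqrt hT0.le).symm⟩
  have hvar : ∫ v, ‖v - U‖ ^ 2 * f v = 3 * ρ * R ^ 2 := by
    rw [hT]
    field_simp
  have hmean : ∫ v, f v • v = ρ • U := by rw [hU, smul_inv_smul₀ hρ0.ne']
  have hpow : (R ^ 2) ^ (-(3 : ℝ) / 2) = (R ^ 3)⁻¹ := by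
    rw [← rpow_natCast, ← rpow_mul hR.le, ← rpow_natCast, ← rpow_neg hR.le]
    norm_num
  rw [hpow, ← div_eq_mul_inv, div_le_iff₀ (by positivity)]
  have hNR : 0 ≤ N * R ^ 3 := by positivity
  rcases le_total (4 * R) ‖U‖ with hfar | hnear
  · have hmass := mass_le_of_far_center (by linarith) hf0 hf hN hR hfar hf2 (hρ ▸ hvar)
    rw [← hρ] at hmass
    have : 0 ≤ 4 ^ q * J * (N * R ^ 3) := by positivity
    linarith
  · obtain ⟨hm, hmom⟩ := integrable_and_integral_norm_sq_mul hf hf1 (hρ ▸ hmean) hf2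
    rw [hvar, ← hρ] at hmom
    have hmass := hJ f hf0 hf N hN R hR hm (by rw [hmom, ← hρ]; nlinarith [sq_nonneg ‖U‖])
    rw [← hρ] at hmass
    have hUq : ρ * ‖U‖ ^ q ≤ 4 ^ q * (ρ * R ^ q) := by
      calc ρ * ‖U‖ ^ q ≤ ρ * (4 * R) ^ q := by gcongr
        _ = 4 ^ q * (ρ * R ^ q) := by rw [mul_rpow (by norm_num) hR.le]; ring
    have h4 : 4 ^ q * (ρ * R ^ q) ≤ 4 ^ q * (J * N * R ^ 3) := by gcongr
    have : 0 ≤ 32 * 2 ^ q * volume.real (Metric.ball (0 : E3) 1) * (N * R ^ 3) := by positivity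
    linarith
end

section
/- Let q > 5 and let C₁, C₂, C₃ > 0 be constants. Suppose f, g : ℝ³ → [0,∞) are measurable functions such that each h ∈ {f, g} satisfies: (i) ‖h‖_q < C₁, (ii) ρ_h + |U_h| + T_h < C₂, and (iii) ρ_h > C₃ and T_h > C₃. Then there exists a constant C > 0, depending only on q, C₁, C₂, C₃, such that ‖M(f) - M(g)‖_q := sup_{v∈ℝ³} (1+|v|)^q |M(f)(v) - M(g)(v)| ≤ C ‖f - g‖_q, where ‖f-g‖_q := sup_{v∈ℝ³} (1+|v|)^q |f(v) - g(v)|. -/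
open MeasureTheory Real

/-- A power of `1 + r` is absorbed by a Gaussian. -/
lemma exists_one_add_rpow_mul_exp_neg_le {s b c : ℝ} (hs : 0 < s) (hb : 0 < b) :
    ∃ M, 0 < M ∧ ∀ r, 0 ≤ r → (1 + r) ^ s * exp (-(b * r ^ 2 - c)) ≤ M := by
  refine ⟨(s / (2 * b)) ^ s * exp (3 * b + c), by positivity, fun r hr => ?_⟩
  have h1 : (1 + r) ≤ s / (2 * b) * exp (2 * b * (1 + r) / s) := by
    have h := add_one_le_exp (2 * b * (1 + r) / s)
    calc (1 + r) = s / (2 * b) * (2 * b * (1 + r) / s) := by field_simp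
      _ ≤ _ := by gcongr; linarith
  have h2 : (1 + r) ^ s ≤ (s / (2 * b)) ^ s * exp (2 * b * (1 + r)) := by
    calc (1 + r) ^ s ≤ (s / (2 * b) * exp (2 * b * (1 + r) / s)) ^ s := by gcongr
      _ = _ := by
        rw [mul_rpow (by positivity) (by positivity), ← exp_mul]
        congr 2
        field_simp
  calc (1 + r) ^ s * exp (-(b * r ^ 2 - c))
      ≤ (s / (2 * b)) ^ s * exp (2 * b * (1 + r)) * exp (-(b * r ^ 2 - c)) := by gcongr
    _ = (s / (2 * b)) ^ s * exp (2 * b * (1 + r) + -(b * r ^ 2 - c)) := by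
      rw [exp_add]; ring
    _ ≤ _ := by
      refine mul_le_mul_of_nonneg_left (exp_le_exp.2 ?_) (by positivity)
      nlinarith [mul_nonneg hb.le (sq_nonneg (r - 1))]

lemma abs_exp_neg_sub_exp_neg_le {w x y : ℝ} (hx : w ≤ x) (hy : w ≤ y) :
    |exp (-x) - exp (-y)| ≤ |x - y| * exp (-w) := by
  wlog hxy : x ≤ y generalizing x y
  · rw [abs_sub_comm, abs_sub_comm x y]
    exact this hy hx (le_of_not_ge hxy)
  have h : exp (-y) = exp (-x) * exp (-(y - x)) := by rw [← exp_add]; congr 1; ring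
  have h1 := add_one_le_exp (-(y - x))
  have h2 : exp (-x) ≤ exp (-w) := exp_le_exp.2 (by linarith)
  rw [abs_of_nonneg (sub_nonneg.2 (exp_le_exp.2 (by linarith))), abs_sub_comm,
    abs_of_nonneg (sub_nonneg.2 hxy), h]
  calc exp (-x) - exp (-x) * exp (-(y - x)) = (1 - exp (-(y - x))) * exp (-x) := by ring
    _ ≤ (y - x) * exp (-x) := mul_le_mul_of_nonneg_right (by linarith) (exp_pos _).le
    _ ≤ _ := by have := sub_nonneg.2 hxy; gcongr

/-- Negative powers are Lipschitz away from the origin. -/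
lemma abs_rpow_neg_sub_rpow_neg_le {p a x y : ℝ} (hp : 0 ≤ p) (ha : 0 < a)
    (hx : a ≤ x) (hy : a ≤ y) :
    |x ^ (-p) - y ^ (-p)| ≤ p * a ^ (-p - 1) * |x - y| := by
  refine (convex_Ici a).norm_image_sub_le_of_norm_hasDerivWithin_le
    (f := fun x : ℝ => x ^ (-p)) (f' := fun x => -p * x ^ (-p - 1)) (fun z hz => ?_)
    (fun z hz => ?_) hy hx
  · exact (hasDerivAt_rpow_const (Or.inl (ha.trans_le hz).ne')).hasDerivWithinAt
  · have hz0 := ha.trans_le hz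
    rw [norm_mul, norm_neg, norm_of_nonneg hp, norm_of_nonneg (by positivity)]
    gcongr ?_ * ?_
    exact rpow_le_rpow_of_nonpos ha hz (by linarith)

section Gaussian

variable {E : Type*} [NormedAddCommGroup E]

lemma abs_sq_norm_sub_div_sub_le {R c T T' : ℝ} {U U' : E} (hc : 0 < c)
    (hU : ‖U‖ ≤ R) (hU' : ‖U'‖ ≤ R) (hT : c ≤ T) (hT' : c ≤ T') (v : E) :
    |‖v - U‖ ^ 2 / (2 * T) - ‖v - U'‖ ^ 2 / (2 * T')| ≤
      ((1 + R) / c + (1 + R) ^ 2 / (2 * c ^ 2)) * (1 + ‖v‖) ^ 2 * (‖U - U'‖ + |T - T'|) := by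
  have hR : 0 ≤ R := (norm_nonneg U).trans hU
  have hT0 := hc.trans_le hT
  have hT0' := hc.trans_le hT'
  have hv := norm_nonneg v
  have bound : ∀ W : E, ‖W‖ ≤ R → ‖v - W‖ ≤ (1 + R) * (1 + ‖v‖) := fun W hW => by
    nlinarith [norm_sub_le v W, mul_nonneg hR hv]
  have hd : |‖v - U‖ - ‖v - U'‖| ≤ ‖U - U'‖ := by
    refine (abs_norm_sub_norm_le _ _).trans_eq ?_
    rw [sub_sub_sub_cancel_left, norm_sub_rev]
  have h1 : |(‖v - U‖ ^ 2 - ‖v - U'‖ ^ 2) / (2 * T)| ≤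
      (1 + R) / c * (1 + ‖v‖) ^ 2 * ‖U - U'‖ := by
    rw [sq_sub_sq, abs_div, abs_mul, abs_of_pos (by positivity : 0 < 2 * T),
      abs_of_nonneg (by positivity)]
    calc (‖v - U‖ + ‖v - U'‖) * |‖v - U‖ - ‖v - U'‖| / (2 * T)
        ≤ ((1 + R) * (1 + ‖v‖) + (1 + R) * (1 + ‖v‖)) * ‖U - U'‖ / (2 * c) := by
          gcongr
          exacts [bound U hU, bound U' hU']
      _ = (1 + R) / c * (1 + ‖v‖) ^ 1 * ‖U - U'‖ := by field_simp; ring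
      _ ≤ _ := by gcongr <;> linarith
  have h2 : |‖v - U'‖ ^ 2 * (T' - T) / (2 * T * T')| ≤
      (1 + R) ^ 2 / (2 * c ^ 2) * (1 + ‖v‖) ^ 2 * |T - T'| := by
    rw [abs_div, abs_mul, abs_of_pos (by positivity : 0 < 2 * T * T'),
      abs_of_nonneg (by positivity : 0 ≤ ‖v - U'‖ ^ 2), abs_sub_comm]
    calc ‖v - U'‖ ^ 2 * |T - T'| / (2 * T * T')
        ≤ ((1 + R) * (1 + ‖v‖)) ^ 2 * |T - T'| / (2 * c * c) := by
          gcongr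
          exact bound U' hU'
      _ = _ := by field_simp
  have e : ‖v - U‖ ^ 2 / (2 * T) - ‖v - U'‖ ^ 2 / (2 * T') =
      (‖v - U‖ ^ 2 - ‖v - U'‖ ^ 2) / (2 * T) + ‖v - U'‖ ^ 2 * (T' - T) / (2 * T * T') := by
    field_simp; ring
  rw [e]
  refine (abs_add_le _ _).trans ((add_le_add h1 h2).trans ?_)
  have p1 : 0 ≤ (1 + R) / c * (1 + ‖v‖) ^ 2 * |T - T'| := by positivity
  have p2 : 0 ≤ (1 + R) ^ 2 / (2 * c ^ 2) * (1 + ‖v‖) ^ 2 * ‖U - U'‖ := by positivity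
  linarith

lemma le_sq_norm_sub_div {R T : ℝ} {U : E} (hR : 0 < R)
    (hU : ‖U‖ ≤ R) (hT : 0 < T) (hTR : T ≤ R) (v : E) :
    1 / (4 * R) * ‖v‖ ^ 2 - R / 2 ≤ ‖v - U‖ ^ 2 / (2 * T) := by
  have h : ‖v‖ ≤ ‖v - U‖ + ‖U‖ := norm_le_norm_sub_add v U
  have h2 : ‖v‖ ^ 2 ≤ 2 * ‖v - U‖ ^ 2 + 2 * R ^ 2 := by
    nlinarith [sq_nonneg (‖v - U‖ - ‖U‖), norm_nonneg v, norm_nonneg U, norm_nonneg (v - U)]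
  calc 1 / (4 * R) * ‖v‖ ^ 2 - R / 2 ≤ 1 / (4 * R) * (2 * ‖v - U‖ ^ 2 + 2 * R ^ 2) - R / 2 := by
        gcongr
    _ = ‖v - U‖ ^ 2 / (2 * R) := by field_simp; ring
    _ ≤ _ := by gcongr

/-- The Maxwellian is Lipschitz in its macroscopic parameters, in the weighted sup norm. -/
lemma exists_maxwellian_lipschitz {q R c : ℝ} (hq : 0 < q) (hR : 0 < R) (hc : 0 < c) :
    ∃ L, 0 < L ∧ ∀ (ρ T ρ' T' : ℝ) (U U' v : E), |ρ'| ≤ R →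
      ‖U‖ ≤ R → ‖U'‖ ≤ R → c ≤ T → c ≤ T' → T ≤ R → T' ≤ R →
      (1 + ‖v‖) ^ q *
        |ρ * (2 * π * T) ^ (-(3 : ℝ) / 2) * exp (-‖v - U‖ ^ 2 / (2 * T)) -
          ρ' * (2 * π * T') ^ (-(3 : ℝ) / 2) * exp (-‖v - U'‖ ^ 2 / (2 * T'))| ≤
        L * (|ρ - ρ'| + ‖U - U'‖ + |T - T'|) := by
  obtain ⟨M, hM, hexp⟩ := exists_one_add_rpow_mul_exp_neg_le (s := q + 2) (b := 1 / (4 * R))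
    (c := R / 2) (by positivity) (by positivity)
  set A : ℝ := (2 * π * c) ^ (-(3 / 2 : ℝ)) with hA
  set A' : ℝ := 3 / 2 * (2 * π * c) ^ (-(3 / 2 : ℝ) - 1) * (2 * π) with hA'
  set B : ℝ := (1 + R) / c + (1 + R) ^ 2 / (2 * c ^ 2) with hB
  have hA0 : 0 < A := by positivity
  have hA0' : 0 < A' := by positivity
  have hB0 : 0 < B := by positivity
  refine ⟨M * (A + R * A' + R * A * B), by positivity, ?_⟩
  intro ρ T ρ' T' U U' v hρ' hU hU' hT hT' hTR hTR'
  have hT0 := hc.trans_le hT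
  have hT0' := hc.trans_le hT'
  have hx := le_sq_norm_sub_div hR hU hT0 hTR v
  have hy := le_sq_norm_sub_div hR hU' hT0' hTR' v
  rw [neg_div, neg_div (2 * T), neg_div (2 * T')]
  set x := ‖v - U‖ ^ 2 / (2 * T) with hxdef
  set y := ‖v - U'‖ ^ 2 / (2 * T') with hydef
  set w := 1 / (4 * R) * ‖v‖ ^ 2 - R / 2 with hw
  set a := (2 * π * T) ^ (-(3 / 2 : ℝ)) with ha
  set a' := (2 * π * T') ^ (-(3 / 2 : ℝ)) with ha'
  have hv1 : 1 ≤ 1 + ‖v‖ := by linarith [norm_nonneg v]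
  have ha0 : 0 ≤ a := by positivity
  have ha0' : 0 ≤ a' := by positivity
  have haA : a ≤ A := rpow_le_rpow_of_nonpos (by positivity) (by gcongr) (by norm_num)
  have haA' : a' ≤ A := rpow_le_rpow_of_nonpos (by positivity) (by gcongr) (by norm_num)
  have haa : |a - a'| ≤ A' * |T - T'| := by
    have := abs_rpow_neg_sub_rpow_neg_le (p := 3 / 2) (a := 2 * π * c) (x := 2 * π * T)
      (y := 2 * π * T') (by norm_num) (by positivity) (by gcongr) (by gcongr)
    rwa [← mul_sub, abs_mul, abs_of_pos (by positivity : 0 < 2 * π), ← mul_assoc] at this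
  have hee : |exp (-x) - exp (-y)| ≤ B * (1 + ‖v‖) ^ 2 * (‖U - U'‖ + |T - T'|) * exp (-w) :=
    (abs_exp_neg_sub_exp_neg_le hx hy).trans
      (mul_le_mul_of_nonneg_right (abs_sq_norm_sub_div_sub_le hc hU hU' hT hT' v) (by positivity))
  have hex : exp (-x) ≤ exp (-w) := exp_le_exp.2 (by linarith)
  have hq2 : (1 + ‖v‖) ^ (q + 2) = (1 + ‖v‖) ^ q * (1 + ‖v‖) ^ 2 := by
    rw [rpow_add (by positivity)]; norm_cast
  have hMw := hexp ‖v‖ (norm_nonneg v)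
  rw [← hw] at hMw
  have hMw' : (1 + ‖v‖) ^ q * exp (-w) ≤ M :=
    le_trans (by gcongr; linarith) hMw
  have e : ρ * a * exp (-x) - ρ' * a' * exp (-y) = (ρ - ρ') * a * exp (-x) +
      ρ' * (a - a') * exp (-x) + ρ' * a' * (exp (-x) - exp (-y)) := by ring
  have key : |ρ * a * exp (-x) - ρ' * a' * exp (-y)| ≤ |ρ - ρ'| * A * exp (-w) +
      R * (A' * |T - T'|) * exp (-w) +
      R * A * (B * (1 + ‖v‖) ^ 2 * (‖U - U'‖ + |T - T'|) * exp (-w)) := by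
    rw [e]
    refine (abs_add_three _ _ _).trans ?_
    simp only [abs_mul, abs_of_nonneg ha0, abs_of_nonneg ha0', abs_exp]
    gcongr
  set D := |ρ - ρ'| + ‖U - U'‖ + |T - T'| with hD
  have hρD : |ρ - ρ'| ≤ D := by rw [hD]; linarith [norm_nonneg (U - U'), abs_nonneg (T - T')]
  have hTD : |T - T'| ≤ D := by rw [hD]; linarith [norm_nonneg (U - U'), abs_nonneg (ρ - ρ')]
  have hUD : ‖U - U'‖ + |T - T'| ≤ D := by rw [hD]; linarith [abs_nonneg (ρ - ρ')]
  have hD0 : 0 ≤ D := (abs_nonneg _).trans hρD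
  calc (1 + ‖v‖) ^ q * |ρ * a * exp (-x) - ρ' * a' * exp (-y)|
      ≤ (1 + ‖v‖) ^ q * (|ρ - ρ'| * A * exp (-w) + R * (A' * |T - T'|) * exp (-w) +
      R * A * (B * (1 + ‖v‖) ^ 2 * (‖U - U'‖ + |T - T'|) * exp (-w))) := by gcongr
    _ = (|ρ - ρ'| * A + R * (A' * |T - T'|)) * ((1 + ‖v‖) ^ q * exp (-w)) +
        R * A * B * (‖U - U'‖ + |T - T'|) * ((1 + ‖v‖) ^ (q + 2) * exp (-w)) := by
      rw [hq2]; ring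
    _ ≤ (D * A + R * (A' * D)) * M + R * A * B * D * M := by gcongr
    _ = _ := by ring

end Gaussian

lemma sq_norm_mul_eq_add {E : Type*} [NormedAddCommGroup E] [InnerProductSpace ℝ E]
    (f : E → ℝ) (U v : E) :
    ‖v‖ ^ 2 * f v = ‖v - U‖ ^ 2 * f v + 2 * inner ℝ U (f v • v) - ‖U‖ ^ 2 * f v := by
  rw [norm_sub_sq_real, inner_smul_right, real_inner_comm]
  ring

section Moments

variable {E : Type*} [NormedAddCommGroup E] [MeasurableSpace E] {μ : Measure E}

/-- A weighted sup bound controls the moments of order at most two. -/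
lemma norm_integral_le_of_weighted_le {F : Type*} [NormedAddCommGroup F] [NormedSpace ℝ F]
    {q N : ℝ} {h : E → ℝ} {φ : E → F}
    (hint : Integrable (fun v : E => (1 + ‖v‖) ^ (-(q - 2))) μ)
    (hh : ∀ v, (1 + ‖v‖) ^ q * |h v| ≤ N)
    (hφ : ∀ v, ‖φ v‖ ≤ (1 + ‖v‖) ^ 2 * |h v|) :
    ‖∫ v, φ v ∂μ‖ ≤ (∫ v, (1 + ‖v‖) ^ (-(q - 2)) ∂μ) * N := by
  rw [← integral_mul_const]
  refine norm_integral_le_of_norm_le (hint.mul_const N) (.of_forall fun v => (hφ v).trans ?_)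
  have hv : 0 < 1 + ‖v‖ := by positivity
  have e : (1 + ‖v‖) ^ 2 = (1 + ‖v‖) ^ (-(q - 2)) * (1 + ‖v‖) ^ q := by
    rw [← rpow_add hv, ← rpow_natCast]; congr 1; push_cast; ring
  rw [e, mul_assoc]
  gcongr
  exact hh v

variable [InnerProductSpace ℝ E]

lemma integrable_sq_norm_mul {f : E → ℝ} {U : E} (h0 : Integrable f μ)
    (h1 : Integrable (fun v => f v • v) μ)
    (h2 : Integrable (fun v => ‖v - U‖ ^ 2 * f v) μ) :
    Integrable (fun v => ‖v‖ ^ 2 * f v) μ := by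
  simp_rw [sq_norm_mul_eq_add f U]
  exact (h2.add ((h1.const_inner U).const_mul 2)).sub (h0.const_mul _)

/-- The second moment about the origin in terms of density, bulk velocity and variance. -/
lemma integral_sq_norm_mul [CompleteSpace E] {f : E → ℝ} {U : E} (h0 : Integrable f μ)
    (h1 : Integrable (fun v => f v • v) μ)
    (h2 : Integrable (fun v => ‖v - U‖ ^ 2 * f v) μ)
    (hU : ∫ v, f v • v ∂μ = (∫ v, f v ∂μ) • U) :
    ∫ v, ‖v‖ ^ 2 * f v ∂μ = ∫ v, ‖v - U‖ ^ 2 * f v ∂μ + (∫ v, f v ∂μ) * ‖U‖ ^ 2 := by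
  simp_rw [sq_norm_mul_eq_add f U]
  have i1 := (h1.const_inner (𝕜 := ℝ) U).const_mul 2
  rw [integral_sub (by exact h2.add i1) (h0.const_mul _), integral_add h2 i1, integral_const_mul,
    integral_const_mul, integral_inner h1, hU, inner_smul_right, real_inner_self_eq_norm_sq]
  ring

end Moments

lemma norm_sub_le_of_norm_smul_sub_smul_le {E : Type*} [NormedAddCommGroup E] [NormedSpace ℝ E]
    {c R k r r' : ℝ} {U U' : E} (hc : 0 < c) (hr : c ≤ r) (hU' : ‖U'‖ ≤ R)
    (h0 : |r - r'| ≤ k) (h1 : ‖r • U - r' • U'‖ ≤ k) :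
    ‖U - U'‖ ≤ (1 + R) / c * k := by
  have hr0 := hc.trans_le hr
  have hR : 0 ≤ R := (norm_nonneg _).trans hU'
  have e : r • (U - U') = (r • U - r' • U') - (r - r') • U' := by module
  have h : r * ‖U - U'‖ ≤ k + k * R := by
    calc r * ‖U - U'‖ = ‖r • (U - U')‖ := by rw [norm_smul, norm_of_nonneg hr0.le]
      _ ≤ ‖r • U - r' • U'‖ + ‖(r - r') • U'‖ := by rw [e]; exact norm_sub_le _ _
      _ ≤ k + k * R := by
        rw [norm_smul, Real.norm_eq_abs]
        have := (abs_nonneg _).trans h0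
        gcongr
  have h' : c * ‖U - U'‖ ≤ k + k * R := le_trans (by gcongr) h
  rw [div_mul_eq_mul_div, le_div_iff₀ hc]
  linarith

lemma abs_sub_le_of_abs_energy_sub_le {E : Type*} [NormedAddCommGroup E]
    {c R k l r r' T T' : ℝ} {U U' : E} (hc : 0 < c) (hr : c ≤ r) (hr' : 0 ≤ r') (hrR' : r' ≤ R)
    (hU : ‖U‖ ≤ R) (hU' : ‖U'‖ ≤ R) (hT' : |T'| ≤ R)
    (h0 : |r - r'| ≤ k) (hUU : ‖U - U'‖ ≤ l)
    (h2 : |(3 * r * T + r * ‖U‖ ^ 2) - (3 * r' * T' + r' * ‖U'‖ ^ 2)| ≤ k) :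
    |T - T'| ≤ ((1 + R ^ 2 + 3 * R) * k + 2 * R ^ 2 * l) / (3 * c) := by
  have hk := (abs_nonneg _).trans h0
  have hR : 0 ≤ R := (norm_nonneg _).trans hU
  have hn : |‖U‖ - ‖U'‖| ≤ l := (abs_norm_sub_norm_le U U').trans hUU
  have hl := (abs_nonneg _).trans hn
  set Z := (3 * r * T + r * ‖U‖ ^ 2) - (3 * r' * T' + r' * ‖U'‖ ^ 2) with hZ
  have e : 3 * r * (T - T') = Z - (r - r') * ‖U‖ ^ 2 -
      r' * ((‖U‖ + ‖U'‖) * (‖U‖ - ‖U'‖)) - 3 * ((r - r') * T') := by rw [hZ]; ring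
  have b1 : |(r - r') * ‖U‖ ^ 2| ≤ k * R ^ 2 := by
    rw [abs_mul, abs_of_nonneg (sq_nonneg ‖U‖)]; gcongr
  have b2 : |r' * ((‖U‖ + ‖U'‖) * (‖U‖ - ‖U'‖))| ≤ R * ((R + R) * l) := by
    rw [abs_mul, abs_mul, abs_of_nonneg hr',
      abs_of_nonneg (add_nonneg (norm_nonneg U) (norm_nonneg U'))]
    gcongr
  have b3 : |(r - r') * T'| ≤ k * R := by rw [abs_mul]; gcongr
  have h : 3 * r * |T - T'| ≤ (1 + R ^ 2 + 3 * R) * k + 2 * R ^ 2 * l := by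
    have hr0 : 0 ≤ 3 * r := by linarith
    rw [← abs_of_nonneg hr0, ← abs_mul, e]
    rw [abs_le] at *
    constructor <;> linarith
  rw [le_div_iff₀ (by positivity)]
  refine le_trans ?_ h
  nlinarith [abs_nonneg (T - T')]

/-- Lipschitz continuity of f ↦ M(f) in the weighted norm ‖·‖_q:
if f and g both satisfy ‖h‖_q ≤ C₁, ρ_h + |U_h| + T_h < C₂, ρ_h > C₃, T_h > C₃,
then ‖M(f) - M(g)‖_q ≤ C ‖f - g‖_q with C depending only on q, C₁, C₂, C₃. -/
theorem lem_lip (q C₁ C₂ C₃ : ℝ) (hq : 5 < q)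
    (hC₁ : 0 < C₁) (hC₂ : 0 < C₂) (hC₃ : 0 < C₃) :
    ∃ C : ℝ, 0 < C ∧
      ∀ (f g : E3 → ℝ),
        Measurable f → (∀ v, 0 ≤ f v) → Integrable f →
        Measurable g → (∀ v, 0 ≤ g v) → Integrable g →
        (∀ v, (1 + ‖v‖) ^ q * f v ≤ C₁) →
        (∀ v, (1 + ‖v‖) ^ q * g v ≤ C₁) →
        ∀ (ρf : ℝ) (Uf : E3) (Tf : ℝ) (ρg : ℝ) (Ug : E3) (Tg : ℝ),
          ρf = ∫ v, f v →
          Integrable (fun v => f v • v) →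
          Uf = ρf⁻¹ • ∫ v, f v • v →
          Integrable (fun v => ‖v - Uf‖ ^ 2 * f v) →
          Tf = (3 * ρf)⁻¹ * ∫ v, ‖v - Uf‖ ^ 2 * f v →
          ρg = ∫ v, g v →
          Integrable (fun v => g v • v) →
          Ug = ρg⁻¹ • ∫ v, g v • v →
          Integrable (fun v => ‖v - Ug‖ ^ 2 * g v) →
          Tg = (3 * ρg)⁻¹ * ∫ v, ‖v - Ug‖ ^ 2 * g v →
          ρf + ‖Uf‖ + Tf < C₂ → ρg + ‖Ug‖ + Tg < C₂ →
          C₃ < ρf → C₃ < Tf → C₃ < ρg → C₃ < Tg →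
          ∀ Nd : ℝ, (∀ v, (1 + ‖v‖) ^ q * |f v - g v| ≤ Nd) →
          ∀ v : E3,
            (1 + ‖v‖) ^ q *
              |ρf * (2 * π * Tf) ^ (-(3 : ℝ) / 2) *
                  Real.exp (-‖v - Uf‖ ^ 2 / (2 * Tf)) -
               ρg * (2 * π * Tg) ^ (-(3 : ℝ) / 2) *
                  Real.exp (-‖v - Ug‖ ^ 2 / (2 * Tg))| ≤ C * Nd := by
  have hint : Integrable (fun v : E3 => (1 + ‖v‖) ^ (-(q - 2))) :=
    integrable_one_add_norm (by rw [finrank_euclideanSpace_fin]; push_cast; linarith)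
  obtain ⟨L, hL, hlip⟩ :=
    exists_maxwellian_lipschitz (E := E3) (q := q) (by linarith) hC₂ hC₃
  set K : ℝ := ∫ v : E3, (1 + ‖v‖) ^ (-(q - 2)) with hK
  have hK0 : 0 ≤ K := integral_nonneg fun v => by positivity
  set B : ℝ := (1 + C₂) / C₃ with hB
  set D : ℝ := ((1 + C₂ ^ 2 + 3 * C₂) + 2 * C₂ ^ 2 * B) / (3 * C₃) with hD
  have hB0 : 0 < B := by positivity
  have hD0 : 0 < D := by positivity
  refine ⟨L * (1 + B + D) * (K + 1), by positivity, ?_⟩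
  intro f g _ _ hf0 _ _ hg0 _ _ ρf Uf Tf ρg Ug Tg hρf hf1 hUf hf2 hTf hρg hg1 hUg hg2 hTg
    hfC hgC hρf3 hTf3 hρg3 hTg3 N hN v
  have hN0 : 0 ≤ N := le_trans (by positivity) (hN 0)
  have hρf0 := hC₃.trans hρf3
  have hρg0 := hC₃.trans hρg3
  have mf1 : ∫ v, f v • v = ρf • Uf := by rw [hUf, smul_inv_smul₀ hρf0.ne']
  have mg1 : ∫ v, g v • v = ρg • Ug := by rw [hUg, smul_inv_smul₀ hρg0.ne']
  have mf2 : ∫ v, ‖v‖ ^ 2 * f v = 3 * ρf * Tf + ρf * ‖Uf‖ ^ 2 := by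
    rw [integral_sq_norm_mul hf0 hf1 hf2 (by rw [mf1, hρf]), ← hρf, hTf,
      mul_inv_cancel_left₀ (by positivity)]
  have mg2 : ∫ v, ‖v‖ ^ 2 * g v = 3 * ρg * Tg + ρg * ‖Ug‖ ^ 2 := by
    rw [integral_sq_norm_mul hg0 hg1 hg2 (by rw [mg1, hρg]), ← hρg, hTg,
      mul_inv_cancel_left₀ (by positivity)]
  have d0 : |ρf - ρg| ≤ K * N := by
    rw [hρf, hρg, ← integral_sub hf0 hg0]
    refine (Real.norm_eq_abs _).symm.trans_le
      (norm_integral_le_of_weighted_le hint hN fun v => ?_)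
    rw [Real.norm_eq_abs]
    exact le_mul_of_one_le_left (abs_nonneg _) (one_le_pow₀ (by linarith [norm_nonneg v]))
  have d1 : ‖ρf • Uf - ρg • Ug‖ ≤ K * N := by
    rw [← mf1, ← mg1, ← integral_sub hf1 hg1]
    refine norm_integral_le_of_weighted_le hint hN fun v => ?_
    rw [← sub_smul, norm_smul, Real.norm_eq_abs, mul_comm]
    gcongr
    nlinarith [norm_nonneg v]
  have d2 : |(3 * ρf * Tf + ρf * ‖Uf‖ ^ 2) - (3 * ρg * Tg + ρg * ‖Ug‖ ^ 2)| ≤ K * N := by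
    rw [← mf2, ← mg2, ← integral_sub (integrable_sq_norm_mul hf0 hf1 hf2)
      (integrable_sq_norm_mul hg0 hg1 hg2)]
    refine (Real.norm_eq_abs _).symm.trans_le
      (norm_integral_le_of_weighted_le hint hN fun v => ?_)
    rw [← mul_sub, norm_mul, Real.norm_eq_abs (f v - g v), norm_of_nonneg (by positivity)]
    gcongr
    linarith
  have nUf := norm_nonneg Uf
  have nUg := norm_nonneg Ug
  have hUU : ‖Uf - Ug‖ ≤ B * (K * N) :=
    norm_sub_le_of_norm_smul_sub_smul_le hC₃ hρf3.le (by linarith) d0 d1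
  have hTT : |Tf - Tg| ≤ D * (K * N) := by
    refine (abs_sub_le_of_abs_energy_sub_le (R := C₂) hC₃ hρf3.le hρg0.le (by linarith) (by linarith)
      (by linarith) (by rw [abs_of_pos] <;> linarith) d0 hUU d2).trans_eq ?_
    rw [hD]; ring
  calc _ ≤ L * (|ρf - ρg| + ‖Uf - Ug‖ + |Tf - Tg|) :=
        hlip ρf Tf ρg Tg Uf Ug v (by rw [abs_of_pos hρg0]; linarith) (by linarith) (by linarith)
          hTf3.le hTg3.le (by linarith) (by linarith)
    _ ≤ L * (K * N + B * (K * N) + D * (K * N)) := by gcongr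
    _ = L * (1 + B + D) * K * N := by ring
    _ ≤ _ := by
      rw [mul_assoc (L * _), mul_assoc (L * _)]
      gcongr
      linarith
end

section
/- Let q > 5 and c₁, c₂ > 0, and let f : ℝ³ × ℝ³ → [0,∞), f = f(x,v), be continuously differentiable in x with ‖f‖_q := sup_{x,v} (1+|v|)^q f(x,v) < ∞ and ‖∇_x f‖_q := sup_{x,v} (1+|v|)^q |∇_x f(x,v)| < ∞, and suppose its macroscopic fields satisfy ρ_f(x) + |U_f(x)| + T_f(x) < c₁ and ρ_f(x), T_f(x) > c₂ for every x. Then there exists a constant C > 0, depending only on q, c₁, c₂, such that ‖∇_{x,v} M(f)‖_q := sup_{x,v} (1+|v|)^q |∇_{x,v} M(f)(x,v)| ≤ C (‖∇_x f‖_q + 1) ‖f‖_q, where ∇_{x,v} denotes the full gradient in both x and v variables. -/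
open MeasureTheory Real

lemma one_add_norm_rpow_mul_sq (q : ℝ) (v : E3) :
    (1 + ‖v‖) ^ (-q) * (1 + ‖v‖) ^ 2 = (1 + ‖v‖) ^ (-(q - 2)) := by
  rw [← Real.rpow_natCast, ← Real.rpow_add (by positivity)]
  congr 1; push_cast; ring

lemma integrable_one_add_norm_rpow_sub_two {q : ℝ} (hq : 5 < q) :
    Integrable (fun v : E3 => (1 + ‖v‖) ^ (-(q - 2))) := by
  refine integrable_one_add_norm ?_
  simp only [finrank_euclideanSpace, Fintype.card_fin]
  push_cast; linarith

lemma le_mul_one_add_norm_rpow_neg {q a B : ℝ} {v : E3} (h : (1 + ‖v‖) ^ q * a ≤ B) :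
    a ≤ B * (1 + ‖v‖) ^ (-q) := by
  have h0 : 0 < (1 + ‖v‖) ^ q := by positivity
  rw [Real.rpow_neg (by positivity), ← div_eq_mul_inv, le_div_iff₀ h0]
  linarith

/-- The `x`-derivative of a jointly measurable function is measurable in the parameter. -/
lemma measurable_fderiv_of_forall_differentiable {f : E3 × E3 → ℝ} (hf : Measurable f)
    (hd : ∀ v : E3, Differentiable ℝ (fun x : E3 => f (x, v))) (x : E3) :
    Measurable (fun v : E3 => fderiv ℝ (fun y : E3 => f (y, v)) x) := by
  have hdir : ∀ e : E3, Measurable (fun v : E3 => fderiv ℝ (fun y : E3 => f (y, v)) x e) := by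
    intro e
    refine measurable_of_tendsto_metrizable
      (f := fun (n : ℕ) (v : E3) => (n : ℝ) • (f (x + (n : ℝ)⁻¹ • e, v) - f (x, v))) ?_ ?_
    · intro n; fun_prop
    · rw [tendsto_pi_nhds]
      intro v
      refine (hd v x).hasFDerivAt.lim_real e |>.comp tendsto_natCast_atTop_atTop |>.congr ?_
      intro n; simp
  have hrepr : (fun v : E3 => fderiv ℝ (fun y : E3 => f (y, v)) x) = fun v =>
      ∑ i : Fin 3, (fderiv ℝ (fun y : E3 => f (y, v)) x (EuclideanSpace.basisFun (Fin 3) ℝ i)) •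
        (EuclideanSpace.proj i : E3 →L[ℝ] ℝ) := by
    ext v y
    conv_lhs => rw [← (EuclideanSpace.basisFun (Fin 3) ℝ).sum_repr y]
    simp [mul_comm]
  rw [hrepr]
  refine Finset.measurable_fun_sum _ fun i _ => ?_
  exact (hdir _).smul_const _

/-- A velocity moment of order at most two is differentiable, with controlled derivative. -/
lemma exists_hasFDerivAt_moment {G : Type*} [NormedAddCommGroup G] [NormedSpace ℝ G]
    [CompleteSpace G] [SecondCountableTopology G] {q Nd : ℝ} (hq : 5 < q)
    {f : E3 × E3 → ℝ} (hf : Measurable f)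
    (hd : ∀ v : E3, Differentiable ℝ (fun x : E3 => f (x, v)))
    (hNd : ∀ (x v : E3), (1 + ‖v‖) ^ q * ‖fderiv ℝ (fun y : E3 => f (y, v)) x‖ ≤ Nd)
    {w : E3 → G} (hw : Continuous w) (hwle : ∀ v, ‖w v‖ ≤ (1 + ‖v‖) ^ 2)
    (hfw : ∀ x, Integrable (fun v => f (x, v) • w v)) (x : E3) :
    ∃ L : E3 →L[ℝ] G, HasFDerivAt (fun y => ∫ v, f (y, v) • w v) L x ∧
      ‖L‖ ≤ Nd * ∫ v : E3, (1 + ‖v‖) ^ (-(q - 2)) := by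
  have hbound : ∀ v y : E3,
      ‖(fderiv ℝ (fun y : E3 => f (y, v)) y).smulRight (w v)‖
        ≤ Nd * (1 + ‖v‖) ^ (-(q - 2)) := by
    intro v y
    rw [ContinuousLinearMap.norm_smulRight_apply, ← one_add_norm_rpow_mul_sq, ← mul_assoc]
    exact mul_le_mul (le_mul_one_add_norm_rpow_neg (hNd y v)) (hwle v) (norm_nonneg _)
      ((norm_nonneg _).trans (le_mul_one_add_norm_rpow_neg (hNd y v)))
  have hbint := (integrable_one_add_norm_rpow_sub_two hq).const_mul Nd
  refine ⟨∫ v, (fderiv ℝ (fun y : E3 => f (y, v)) x).smulRight (w v), ?_, ?_⟩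
  · refine hasFDerivAt_integral_of_dominated_of_fderiv_le
      (F' := fun y v => (fderiv ℝ (fun y : E3 => f (y, v)) y).smulRight (w v))
      (bound := fun v => Nd * (1 + ‖v‖) ^ (-(q - 2))) (s := Set.univ) Filter.univ_mem
      (Filter.Eventually.of_forall fun y => (hfw y).aestronglyMeasurable) (hfw x) ?_
      (Filter.Eventually.of_forall fun v y _ => hbound v y) hbint
      (Filter.Eventually.of_forall fun v y _ => (hd v y).hasFDerivAt.smul_const (w v))
    have h1 := (measurable_fderiv_of_forall_differentiable hf hd x).stronglyMeasurable
    have h2 : Continuous fun p : (E3 →L[ℝ] ℝ) × G => p.1.smulRight p.2 := by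
      exact (ContinuousLinearMap.smulRightL ℝ E3 G).continuous₂
    exact (h2.comp_stronglyMeasurable (h1.prodMk hw.stronglyMeasurable)).aestronglyMeasurable
  · rw [← integral_const_mul]
    exact norm_integral_le_of_norm_le hbint (Filter.Eventually.of_forall fun v => hbound v x)

lemma exists_hasFDerivAt_inv_smul {E G : Type*} [NormedAddCommGroup E] [NormedSpace ℝ E]
    [NormedAddCommGroup G] [NormedSpace ℝ G] {ρ : E → ℝ} {φ : E → G} {x : E} {R : E →L[ℝ] ℝ}
    {L : E →L[ℝ] G} {c B D : ℝ} (hc : 0 < c) (hρ : c < ρ x) (hR : HasFDerivAt ρ R x)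
    (hL : HasFDerivAt φ L x) (hRD : ‖R‖ ≤ D) (hLD : ‖L‖ ≤ D) (hB : ‖(ρ x)⁻¹ • φ x‖ ≤ B) :
    ∃ L' : E →L[ℝ] G, HasFDerivAt (fun y => (ρ y)⁻¹ • φ y) L' x ∧
      ‖L'‖ ≤ c⁻¹ * (1 + B) * D := by
  have hpos : 0 < ρ x := hc.trans hρ
  have hinv : (ρ x)⁻¹ ≤ c⁻¹ := inv_anti₀ hc hρ.le
  have hi : HasFDerivAt (fun y => (ρ y)⁻¹) (-(ρ x ^ 2)⁻¹ • R) x :=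
    (hasDerivAt_inv hpos.ne').comp_hasFDerivAt x hR
  have h := hi.fun_smul hL
  refine ⟨_, h, ?_⟩
  have hD : 0 ≤ D := (norm_nonneg _).trans hRD
  have hB0 : 0 ≤ B := (norm_nonneg _).trans hB
  refine (norm_add_le _ _).trans ?_
  have h1 : ‖(ρ x)⁻¹ • L‖ ≤ c⁻¹ * D := by
    rw [norm_smul, Real.norm_of_nonneg (by positivity)]
    gcongr
  have h2 : ‖(-(ρ x ^ 2)⁻¹ • R).smulRight (φ x)‖ ≤ c⁻¹ * D * B := by
    rw [ContinuousLinearMap.norm_smulRight_apply, norm_smul, norm_neg,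
      Real.norm_of_nonneg (by positivity)]
    rw [norm_smul, Real.norm_of_nonneg (by positivity)] at hB
    calc (ρ x ^ 2)⁻¹ * ‖R‖ * ‖φ x‖ = (ρ x)⁻¹ * ‖R‖ * ((ρ x)⁻¹ * ‖φ x‖) := by
          field_simp
      _ ≤ c⁻¹ * D * B := by gcongr
  linarith

/-- Gaussian decay absorbs polynomial weights. -/
lemma one_add_rpow_mul_exp_le {q c s t : ℝ} (hq : 0 < q) (hc : 0 < c) (hs : 0 ≤ s) (ht : 0 ≤ t)
    (hts : t ≤ c + s) :
    (1 + t) ^ q * ((1 + s) ^ 2 * Real.exp (-s ^ 2 / (2 * c))) ≤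
      Real.exp (q * c + (q + 2) ^ 2 * c / 2) := by
  have h1 : (1 + t) ^ q ≤ Real.exp (q * (c + s)) := by
    rw [mul_comm q, Real.exp_mul]
    refine Real.rpow_le_rpow (by positivity) ?_ hq.le
    linarith [Real.add_one_le_exp (c + s)]
  have h2 : (1 + s) ^ 2 ≤ Real.exp (2 * s) := by
    rw [mul_comm, Real.exp_mul, Real.rpow_two]
    gcongr
    linarith [Real.add_one_le_exp s]
  calc _ ≤ Real.exp (q * (c + s)) * (Real.exp (2 * s) * Real.exp (-s ^ 2 / (2 * c))) := by
        gcongr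
    _ = Real.exp (q * (c + s) + (2 * s + -s ^ 2 / (2 * c))) := by rw [Real.exp_add, Real.exp_add]
    _ ≤ _ := by
        refine Real.exp_le_exp.mpr ?_
        have : 0 ≤ (s - (q + 2) * c) ^ 2 / (2 * c) := by positivity
        have h3 : (s - (q + 2) * c) ^ 2 / (2 * c) =
            -(-s ^ 2 / (2 * c)) - (q + 2) * s + (q + 2) ^ 2 * c / 2 := by
          field_simp; ring
        linarith

/-- The gradient of a Maxwellian, in terms of the gradients of its parameters. -/
lemma norm_fderiv_maxwellian_le {ρ T : E3 → ℝ} {U : E3 → E3} {M : E3 × E3 → ℝ} {c D : ℝ}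
    {x : E3} {R S : E3 →L[ℝ] ℝ} {V : E3 →L[ℝ] E3} (hc : 0 < c)
    (hρ : ∀ y, c < ρ y) (hT : ∀ y, c < T y)
    (hM : ∀ y v, M (y, v) = ρ y * (2 * π * T y) ^ (-(3 : ℝ) / 2) *
      Real.exp (-‖v - U y‖ ^ 2 / (2 * T y)))
    (hR : HasFDerivAt ρ R x) (hV : HasFDerivAt U V x) (hS : HasFDerivAt T S x)
    (hRD : ‖R‖ ≤ D) (hVD : ‖V‖ ≤ D) (hSD : ‖S‖ ≤ D) (v : E3) :
    ‖fderiv ℝ M (x, v)‖ ≤ M (x, v) *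
      ((5 / 2 * c⁻¹ + c⁻¹ + c⁻¹ ^ 2) * (1 + D) * (1 + ‖v - U x‖) ^ 2) := by
  have hTpos : ∀ y, 0 < T y := fun y => hc.trans (hT y)
  have hρpos : ∀ y, 0 < ρ y := fun y => hc.trans (hρ y)
  have hMexp : M = fun z => Real.exp (Real.log (ρ z.1) + (-(3 : ℝ) / 2) * Real.log (2 * π * T z.1)
      - ‖z.2 - U z.1‖ ^ 2 * ((2 : ℝ)⁻¹ * (T z.1)⁻¹)) := by
    funext ⟨y, w⟩
    have := hTpos y
    rw [hM, sub_eq_add_neg (_ + _), Real.exp_add, Real.exp_add, Real.exp_log (hρpos y),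
      Real.rpow_def_of_pos (by positivity), mul_comm (Real.log _)]
    congr 2
    field_simp
  have hfst : HasFDerivAt (Prod.fst : E3 × E3 → E3) (ContinuousLinearMap.fst ℝ E3 E3) (x, v) :=
    hasFDerivAt_fst
  have hsnd : HasFDerivAt (Prod.snd : E3 × E3 → E3) (ContinuousLinearMap.snd ℝ E3 E3) (x, v) :=
    hasFDerivAt_snd
  set P := ContinuousLinearMap.fst ℝ E3 E3
  have hPn : ‖P‖ ≤ 1 := ContinuousLinearMap.norm_fst_le ..
  have hR' : HasFDerivAt (fun z : E3 × E3 => ρ z.1) (R.comp P) (x, v) :=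
    HasFDerivAt.comp (x, v) (f := Prod.fst) hR hfst
  have hS' : HasFDerivAt (fun z : E3 × E3 => T z.1) (S.comp P) (x, v) :=
    HasFDerivAt.comp (x, v) (f := Prod.fst) hS hfst
  have hV' : HasFDerivAt (fun z : E3 × E3 => U z.1) (V.comp P) (x, v) :=
    HasFDerivAt.comp (x, v) (f := Prod.fst) hV hfst
  have hD : 0 ≤ D := (norm_nonneg _).trans hRD
  have comp_le : ∀ {H : Type} [NormedAddCommGroup H] [NormedSpace ℝ H] (A : E3 →L[ℝ] H),
      ‖A‖ ≤ D → ‖A.comp P‖ ≤ D := fun A hA =>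
    (A.opNorm_comp_le P).trans <| by
      calc ‖A‖ * ‖P‖ ≤ D * 1 := by gcongr
        _ = D := mul_one D
  have hRn := comp_le R hRD
  have hSn := comp_le S hSD
  have hVn := comp_le V hVD
  have hx := hTpos x
  have hi : HasFDerivAt (fun z : E3 × E3 => (T z.1)⁻¹) (-(T x ^ 2)⁻¹ • S.comp P) (x, v) :=
    (hasDerivAt_inv hx.ne').comp_hasFDerivAt (x, v) hS'
  have hg := ((hR'.log (hρpos x).ne').fun_add
    (((hS'.const_mul (2 * π)).log (by positivity)).const_mul (-(3 : ℝ) / 2))).fun_sub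
    ((hsnd.fun_sub hV').norm_sq.fun_mul (hi.const_mul (2 : ℝ)⁻¹))
  have hE := hg.exp
  rw [← hMexp] at hE
  rw [hE.fderiv, norm_smul]
  have hMpos : 0 ≤ M (x, v) := by rw [hMexp]; positivity
  rw [← congrFun hMexp (x, v), Real.norm_of_nonneg hMpos]
  gcongr
  have hρi : (ρ x)⁻¹ ≤ c⁻¹ := inv_anti₀ hc (hρ x).le
  have hTi : (T x)⁻¹ ≤ c⁻¹ := inv_anti₀ hc (hT x).le
  set s := ‖v - U x‖ with hs
  have hs0 : 0 ≤ s := norm_nonneg _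
  have n1 : ‖(ρ x)⁻¹ • R.comp P‖ ≤ c⁻¹ * D := by
    rw [norm_smul, Real.norm_of_nonneg (by have := hρpos x; positivity)]
    gcongr
  have n2 : ‖(-(3 : ℝ) / 2) • (2 * π * T x)⁻¹ • (2 * π) • S.comp P‖ ≤ 3 / 2 * (c⁻¹ * D) := by
    rw [smul_smul (2 * π * T x)⁻¹, show (2 * π * T x)⁻¹ * (2 * π) = (T x)⁻¹ by field_simp,
      norm_smul, norm_smul, Real.norm_of_nonneg (by positivity : 0 ≤ (T x)⁻¹)]
    norm_num
    gcongr
  have n3 : ‖s ^ 2 • (2 : ℝ)⁻¹ • -(T x ^ 2)⁻¹ • S.comp P‖ ≤ s ^ 2 * (2⁻¹ * (c⁻¹ ^ 2 * D)) := by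
    rw [norm_smul, norm_smul, norm_smul, norm_neg, ← inv_pow,
      Real.norm_of_nonneg (by positivity : 0 ≤ s ^ 2),
      Real.norm_of_nonneg (by positivity : 0 ≤ (2 : ℝ)⁻¹),
      Real.norm_of_nonneg (by positivity : 0 ≤ (T x)⁻¹ ^ 2)]
    gcongr
  have n4 : ‖((2 : ℝ)⁻¹ * (T x)⁻¹) • (2 : ℕ) • (innerSL ℝ (v - U x)).comp
      (ContinuousLinearMap.snd ℝ E3 E3 - V.comp P)‖ ≤ c⁻¹ * (s * (1 + D)) := by
    rw [← Nat.cast_smul_eq_nsmul ℝ, smul_smul,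
      show (2 : ℝ)⁻¹ * (T x)⁻¹ * ((2 : ℕ) : ℝ) = (T x)⁻¹ by push_cast; field_simp,
      norm_smul, Real.norm_of_nonneg (by positivity)]
    have h1 := ContinuousLinearMap.opNorm_comp_le (innerSL ℝ (v - U x))
      (ContinuousLinearMap.snd ℝ E3 E3 - V.comp P)
    rw [innerSL_apply_norm, ← hs] at h1
    have h2 : ‖ContinuousLinearMap.snd ℝ E3 E3 - V.comp P‖ ≤ 1 + D :=
      (norm_sub_le _ _).trans (add_le_add (ContinuousLinearMap.norm_snd_le ..) hVn)
    have h3 := h1.trans (mul_le_mul_of_nonneg_left h2 hs0)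
    gcongr
  refine (norm_sub_le _ _).trans ((add_le_add (norm_add_le _ _) (norm_add_le _ _)).trans ?_)
  refine (add_le_add (add_le_add n1 n2) (add_le_add n3 n4)).trans ?_
  have hc' : 0 < c⁻¹ := by positivity
  have e1 : D ≤ (1 + D) * (1 + s) ^ 2 := by nlinarith [mul_nonneg hD hs0, sq_nonneg s]
  have e2 : s * (1 + D) ≤ (1 + D) * (1 + s) ^ 2 := by
    rw [mul_comm]; gcongr; nlinarith
  have e3 : s ^ 2 * 2⁻¹ * D ≤ (1 + D) * (1 + s) ^ 2 := by
    rw [mul_comm]; gcongr <;> nlinarith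
  have k1 := mul_le_mul_of_nonneg_left e1 hc'.le
  have k2 := mul_le_mul_of_nonneg_left e2 hc'.le
  have k3 := mul_le_mul_of_nonneg_left e3 (sq_nonneg c⁻¹)
  linarith

lemma weighted_le_of_le_gaussian {q c s t m g B C D : ℝ} (hq : 0 < q) (hc : 0 < c) (hB : 0 ≤ B)
    (hC : 0 ≤ C) (hD : 0 ≤ D) (hs : 0 ≤ s) (ht : 0 ≤ t) (hts : t ≤ c + s)
    (hm : m ≤ B * Real.exp (-s ^ 2 / (2 * c))) (hg : g ≤ m * (C * (1 + D) * (1 + s) ^ 2)) :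
    (1 + t) ^ q * g ≤ B * C * (1 + D) * Real.exp (q * c + (q + 2) ^ 2 * c / 2) := by
  calc (1 + t) ^ q * g
      ≤ (1 + t) ^ q * (B * Real.exp (-s ^ 2 / (2 * c)) * (C * (1 + D) * (1 + s) ^ 2)) := by
        refine mul_le_mul_of_nonneg_left ?_ (by positivity)
        exact hg.trans (mul_le_mul_of_nonneg_right hm (by positivity))
    _ = B * C * (1 + D) * ((1 + t) ^ q * ((1 + s) ^ 2 * Real.exp (-s ^ 2 / (2 * c)))) := by ring
    _ ≤ _ := mul_le_mul_of_nonneg_left (one_add_rpow_mul_exp_le hq hc hs ht hts) (by positivity)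

lemma integrable_smul_of_weighted_bound {G : Type*} [NormedAddCommGroup G] [NormedSpace ℝ G]
    [SecondCountableTopology G] {q N : ℝ} (hq : 5 < q) {g : E3 → ℝ} (hg : Measurable g)
    (hg0 : ∀ v, 0 ≤ g v) (hN : ∀ v : E3, (1 + ‖v‖) ^ q * g v ≤ N)
    {w : E3 → G} (hw : Continuous w) (hwle : ∀ v, ‖w v‖ ≤ (1 + ‖v‖) ^ 2) :
    Integrable (fun v => g v • w v) := by
  refine ((integrable_one_add_norm_rpow_sub_two hq).const_mul N).mono'
    (hg.aestronglyMeasurable.smul hw.aestronglyMeasurable)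
    (Filter.Eventually.of_forall fun v => ?_)
  have h := le_mul_one_add_norm_rpow_neg (hN v)
  rw [norm_smul, Real.norm_of_nonneg (hg0 v), ← one_add_norm_rpow_mul_sq, ← mul_assoc]
  exact mul_le_mul h (hwle v) (norm_nonneg _) ((hg0 v).trans h)

/-- Second moment about the mean in terms of the raw second moment. -/
lemma integral_norm_sub_sq_mul {g : E3 → ℝ} {r : ℝ} {u : E3} (h0 : Integrable g)
    (h1 : Integrable (fun v => g v • v)) (h2 : Integrable (fun v => g v • ‖v‖ ^ 2))
    (hr : r = ∫ v, g v) (hr0 : r ≠ 0) (hu : u = r⁻¹ • ∫ v, g v • v) :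
    ∫ v, ‖v - u‖ ^ 2 * g v = (∫ v, g v • ‖v‖ ^ 2) - r * ‖u‖ ^ 2 := by
  have hm : ∫ v, g v • v = r • u := by rw [hu, smul_inv_smul₀ hr0]
  have hin : Integrable (fun v => inner ℝ u (g v • v)) := h1.const_inner u
  have hI : ∫ v, inner ℝ u (g v • v) = r * ‖u‖ ^ 2 := by
    rw [integral_inner h1, hm, inner_smul_right, real_inner_self_eq_norm_sq]
  calc ∫ v, ‖v - u‖ ^ 2 * g v
      = ∫ v, (g v • ‖v‖ ^ 2 - 2 * inner ℝ u (g v • v)) + ‖u‖ ^ 2 * g v := by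
        refine integral_congr_ae (Filter.Eventually.of_forall fun v => ?_)
        simp only [norm_sub_sq_real, inner_smul_right, smul_eq_mul, real_inner_comm v u]
        ring
    _ = _ := by
        have h3 : Integrable fun v => g v • ‖v‖ ^ 2 - 2 * inner ℝ u (g v • v) :=
          h2.sub (hin.const_mul 2)
        rw [integral_add h3 (h0.const_mul _),
          integral_sub h2 (hin.const_mul 2), integral_const_mul, integral_const_mul, hI, ← hr]
        ring

/-- for q > 5 and constants c₁, c₂ > 0, if f = f(x,v) is
continuously differentiable in x with ‖f‖_q, ‖∇_x f‖_q finite and its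
macroscopic fields satisfy ρ_f + |U_f| + T_f < c₁, ρ_f, T_f > c₂ everywhere,
then ‖∇_{x,v} M(f)‖_q ≤ C (‖∇_x f‖_q + 1) ‖f‖_q with C = C(q, c₁, c₂). -/
theorem lem_macro_gradient (q c₁ c₂ : ℝ) (hq : 5 < q) (hc₁ : 0 < c₁) (hc₂ : 0 < c₂) :
    ∃ C : ℝ, 0 < C ∧
      ∀ (f : E3 × E3 → ℝ),
        Measurable f → (∀ z, 0 ≤ f z) →
        (∀ v : E3, ContDiff ℝ 1 (fun x : E3 => f (x, v))) →
        ∀ N : ℝ, (∀ (x v : E3), (1 + ‖v‖) ^ q * f (x, v) ≤ N) →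
        ∀ Nd : ℝ,
          (∀ (x v : E3), (1 + ‖v‖) ^ q * ‖fderiv ℝ (fun y : E3 => f (y, v)) x‖ ≤ Nd) →
        ∀ (ρf : E3 → ℝ) (Uf : E3 → E3) (Tf : E3 → ℝ),
          (∀ x, Integrable (fun v => f (x, v))) →
          (∀ x, ρf x = ∫ v, f (x, v)) →
          (∀ x, Integrable (fun v => f (x, v) • v)) →
          (∀ x, Uf x = (ρf x)⁻¹ • ∫ v, f (x, v) • v) →
          (∀ x, Integrable (fun v => ‖v - Uf x‖ ^ 2 * f (x, v))) →
          (∀ x, Tf x = (3 * ρf x)⁻¹ * ∫ v, ‖v - Uf x‖ ^ 2 * f (x, v)) →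
          (∀ x, ρf x + ‖Uf x‖ + Tf x < c₁) →
          (∀ x, c₂ < ρf x) → (∀ x, c₂ < Tf x) →
          ∀ (Mf : E3 × E3 → ℝ),
            (∀ (x v : E3), Mf (x, v) = ρf x * (2 * π * Tf x) ^ (-(3 : ℝ) / 2) *
                Real.exp (-‖v - Uf x‖ ^ 2 / (2 * Tf x))) →
            ∀ (x v : E3),
              (1 + ‖v‖) ^ q * ‖fderiv ℝ Mf (x, v)‖ ≤ C * (Nd + 1) * N := by
  set K := ∫ v : E3, (1 + ‖v‖) ^ (-(q - 2)) with hK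
  have hKpos : 0 < K := by
    rw [hK, integral_pos_iff_support_of_nonneg (fun v => by positivity)
      (integrable_one_add_norm_rpow_sub_two hq)]
    have : Function.support (fun v : E3 => (1 + ‖v‖) ^ (-(q - 2))) = Set.univ := by
      ext v
      simpa using (show (1 + ‖v‖) ^ (-(q - 2)) ≠ 0 by positivity)
    rw [this]
    exact Measure.measure_univ_pos.mpr (NeZero.ne _)
  set A₁ := c₂⁻¹ * (1 + c₁) * K with hA₁
  set A₂ := c₂⁻¹ * (1 + (3 * c₁ + c₁ ^ 2)) * K with hA₂
  set A := K + A₁ + 3⁻¹ * (A₂ + 2 * c₁ * A₁) with hA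
  have hA₁0 : 0 < A₁ := by positivity
  have hA₂0 : 0 < A₂ := by positivity
  have hA0 : 0 < A := by positivity
  set B := c₁ * (2 * π * c₂) ^ (-(3 : ℝ) / 2) with hB
  have hB0 : 0 < B := by positivity
  set C₁ := 5 / 2 * c₂⁻¹ + c₂⁻¹ + c₂⁻¹ ^ 2 with hC₁
  have hC₁0 : 0 < C₁ := by positivity
  set Q := Real.exp (q * c₁ + (q + 2) ^ 2 * c₁ / 2) with hQ
  have hQ0 : 0 < Q := Real.exp_pos _
  refine ⟨B * C₁ * Q * (1 + A) * (K / c₂), by positivity, ?_⟩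
  intro f hf hf0 hdiff N hN Nd hNd ρf Uf Tf hi0 hρ hi1 hU _ hT hc hρc hTc Mf hM x v
  have hd : ∀ v : E3, Differentiable ℝ (fun x : E3 => f (x, v)) := fun v =>
    (hdiff v).differentiable one_ne_zero
  have hsq : ∀ v : E3, ‖‖v‖ ^ 2‖ ≤ (1 + ‖v‖) ^ 2 := fun v => by
    rw [Real.norm_of_nonneg (by positivity)]
    gcongr
    linarith
  have hid : ∀ v : E3, ‖v‖ ≤ (1 + ‖v‖) ^ 2 := fun v => by nlinarith [norm_nonneg v]
  have hone : ∀ v : E3, ‖(1 : ℝ)‖ ≤ (1 + ‖v‖) ^ 2 := fun v => by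
    rw [norm_one]; nlinarith [norm_nonneg v]
  have hi2 : ∀ x, Integrable (fun v => f (x, v) • ‖v‖ ^ 2) := fun x =>
    integrable_smul_of_weighted_bound hq (by fun_prop) (fun v => hf0 _) (hN x) (by fun_prop) hsq
  have hi0' : ∀ x, Integrable (fun v => f (x, v) • (1 : ℝ)) := fun x => by simpa using hi0 x
  have hNd0 : 0 ≤ Nd := le_trans (by positivity) (hNd 0 0)
  have hN0 : 0 ≤ N := le_trans (mul_nonneg (by positivity) (hf0 (0, 0))) (hN 0 0)
  have hNK : 1 ≤ K / c₂ * N := by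
    have h1 : ρf x ≤ N * K := by
      rw [hρ x, hK, ← integral_const_mul]
      refine integral_mono (hi0 x) ((integrable_one_add_norm_rpow_sub_two hq).const_mul N) ?_
      intro v
      refine (le_mul_one_add_norm_rpow_neg (hN x v)).trans ?_
      dsimp only
      gcongr
      · linarith [norm_nonneg v]
      · linarith
    rw [div_mul_eq_mul_div, le_div_iff₀ hc₂]
    linarith [hρc x]
  have hρpos : ∀ y, 0 < ρf y := fun y => hc₂.trans (hρc y)
  have hTpos : ∀ y, 0 < Tf y := fun y => hc₂.trans (hTc y)
  have hUle : ‖Uf x‖ ≤ c₁ := by linarith [hc x, hρpos x, hTpos x]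
  have hTle : Tf x ≤ c₁ := by linarith [hc x, hρpos x, norm_nonneg (Uf x)]
  have hρle : ρf x ≤ c₁ := by linarith [hc x, hTpos x, norm_nonneg (Uf x)]
  obtain ⟨R, hR, hRn⟩ := exists_hasFDerivAt_moment hq hf hd hNd continuous_const hone hi0' x
  obtain ⟨V₀, hV₀, hV₀n⟩ := exists_hasFDerivAt_moment hq hf hd hNd (w := fun v => v) continuous_id hid hi1 x
  obtain ⟨S₀, hS₀, hS₀n⟩ := exists_hasFDerivAt_moment hq hf hd hNd (w := fun v => ‖v‖ ^ 2)
    (continuous_norm.pow 2) hsq hi2 x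
  rw [← hK] at hRn hV₀n hS₀n
  have hρR : HasFDerivAt ρf R x :=
    hR.congr_of_eventuallyEq (Filter.Eventually.of_forall fun y => by simp [hρ y])
  have hEeq : ∀ y, (ρf y)⁻¹ • ∫ v, f (y, v) • ‖v‖ ^ 2 = 3 * Tf y + ‖Uf y‖ ^ 2 := fun y => by
    have h := integral_norm_sub_sq_mul (hi0 y) (hi1 y) (hi2 y) (hρ y) (hρpos y).ne' (hU y)
    have := (hρpos y).ne'
    rw [hT y, h, smul_eq_mul]
    field_simp
    ring
  obtain ⟨V, hV, hVn⟩ := exists_hasFDerivAt_inv_smul (B := c₁) hc₂ (hρc x) hρR hV₀ hRn hV₀n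
    ((congrArg norm (hU x)).symm.trans_le hUle)
  obtain ⟨S, hS, hSn⟩ := exists_hasFDerivAt_inv_smul (B := 3 * c₁ + c₁ ^ 2) hc₂ (hρc x) hρR
    hS₀ hRn hS₀n (by
      rw [hEeq x, Real.norm_of_nonneg (by have := hTpos x; positivity)]
      gcongr)
  have hUV : HasFDerivAt Uf V x :=
    hV.congr_of_eventuallyEq (Filter.Eventually.of_forall hU)
  have hVA : ‖V‖ ≤ A₁ * Nd := hVn.trans_eq (by rw [hA₁]; ring)
  have hSA : ‖S‖ ≤ A₂ * Nd := hSn.trans_eq (by rw [hA₂]; ring)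
  have hTS : HasFDerivAt Tf ((3 : ℝ)⁻¹ • (S - (2 : ℕ) • (innerSL ℝ (Uf x)).comp V)) x := by
    refine ((hS.fun_sub hUV.norm_sq).const_mul (3 : ℝ)⁻¹).congr_of_eventuallyEq
      (Filter.Eventually.of_forall fun y => ?_)
    dsimp only
    rw [hEeq y]; ring
  have hTSn : ‖(3 : ℝ)⁻¹ • (S - (2 : ℕ) • (innerSL ℝ (Uf x)).comp V)‖ ≤ A * Nd := by
    have h1 : ‖(innerSL ℝ (Uf x)).comp V‖ ≤ c₁ * (A₁ * Nd) := by
      refine (ContinuousLinearMap.opNorm_comp_le _ _).trans ?_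
      rw [innerSL_apply_norm]
      gcongr
    have h2 : ‖(2 : ℕ) • (innerSL ℝ (Uf x)).comp V‖ ≤ 2 * (c₁ * (A₁ * Nd)) := by
      rw [two_smul]
      linarith [norm_add_le ((innerSL ℝ (Uf x)).comp V) ((innerSL ℝ (Uf x)).comp V)]
    rw [norm_smul, norm_inv, Real.norm_of_nonneg (by norm_num : (0 : ℝ) ≤ 3)]
    have h3 := norm_sub_le S ((2 : ℕ) • (innerSL ℝ (Uf x)).comp V)
    have h4 : 0 ≤ K * Nd + A₁ * Nd := by positivity
    rw [hA]
    linarith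
  have hRA : ‖R‖ ≤ A * Nd := by
    refine hRn.trans ?_
    rw [mul_comm]
    gcongr
    rw [hA, add_assoc]
    exact le_add_of_nonneg_right (by positivity)
  have hVA' : ‖V‖ ≤ A * Nd := by
    refine hVA.trans ?_
    gcongr
    rw [hA, add_right_comm]
    exact le_add_of_nonneg_left (by positivity)
  have hfd := norm_fderiv_maxwellian_le hc₂ hρc hTc hM hρR hUV hTS hRA hVA' hTSn v
  set s := ‖v - Uf x‖ with hs
  have hMle : Mf (x, v) ≤ B * Real.exp (-s ^ 2 / (2 * c₁)) := by
    rw [hM, hB]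
    have hTx := hTpos x
    have h1 : (2 * π * Tf x) ^ (-(3 : ℝ) / 2) ≤ (2 * π * c₂) ^ (-(3 : ℝ) / 2) := by
      refine Real.rpow_le_rpow_of_nonpos (by positivity) ?_ (by norm_num)
      have := hTc x
      gcongr
    have h2 : Real.exp (-s ^ 2 / (2 * Tf x)) ≤ Real.exp (-s ^ 2 / (2 * c₁)) := by
      rw [Real.exp_le_exp, neg_div, neg_div, neg_le_neg_iff]
      gcongr
    gcongr
  have hvs : ‖v‖ ≤ c₁ + s := by
    have := norm_le_norm_add_norm_sub (Uf x) v
    rw [norm_sub_rev] at this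
    linarith
  have hest := weighted_le_of_le_gaussian (by linarith : 0 < q) hc₁ hB0.le hC₁0.le
    (mul_nonneg hA0.le hNd0) (norm_nonneg _) (norm_nonneg v) hvs hMle hfd
  rw [← hQ] at hest
  refine hest.trans ?_
  clear_value K A B C₁ Q
  clear * - hKpos hA0 hB0 hC₁0 hQ0 hNK hNd0 hc₂
  have h1 : 1 + A * Nd ≤ (1 + A) * (Nd + 1) := by nlinarith
  calc B * C₁ * (1 + A * Nd) * Q ≤ B * C₁ * ((1 + A) * (Nd + 1)) * Q := by gcongr
    _ = B * C₁ * Q * (1 + A) * (Nd + 1) * 1 := by ring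
    _ ≤ B * C₁ * Q * (1 + A) * (Nd + 1) * (K / c₂ * N) := by gcongr
    _ = B * C₁ * Q * (1 + A) * (K / c₂) * (Nd + 1) * N := by ring
end
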